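/- Each of the Gelfand–Tsetlin operators E_{k,k+1} and E_{k+1,k} for 1 ≤ k ≤ n−1, and E_{k,k} for 1 ≤ k ≤ n, maps L_η into L_η; that is, L_η is stable under the gl(n,ℂ)-action on V_K given by the Gelfand–Tsetlin formulas. -/

import Mathlib

open scoped BigOperators

set_option maxHeartbeats 1000000
set_option synthInstance.maxHeartbeats 400000
noncomputable section

namespace GTpaper

variable (r : ℕ) (η : Fin r → ℕ)

/-- The index set Σ(η): pairs (k,i) with 1 ≤ k ≤ r, 1 ≤ i ≤ η_k (0-based). -/
abbrev Idx := (k : Fin r) × Fin (η k)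

/-- The polynomial ring ℂ[X_η]. -/
abbrev Pol := MvPolynomial (Idx r η) ℂ

/-- The field of rational functions F = ℂ(X_η). -/
abbrev FF := FractionRing (Pol r η)

/-- The group S_η = S_{η_1} × ⋯ × S_{η_r}. -/
abbrev Sg := ∀ k : Fin r, Equiv.Perm (Fin (η k))

/-- The action of S_η on the index set. -/
def permIdx (σ : Sg r η) : Equiv.Perm (Idx r η) where
  toFun p := ⟨p.1, σ p.1 p.2⟩
  invFun p := ⟨p.1, (σ p.1)⁻¹ p.2⟩
  left_inv p := by simp
  right_inv p := by simp

/-- The action of S_η on ℂ[X_η] by permuting variables. -/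
def actP (σ : Sg r η) : Pol r η ≃+* Pol r η :=
  (MvPolynomial.renameEquiv ℂ (permIdx r η σ)).toRingEquiv

/-- The action of S_η on F = ℂ(X_η) by field automorphisms. -/
def actF (σ : Sg r η) : FF r η ≃+* FF r η :=
  IsFractionRing.ringEquivOfRingEquiv (actP r η σ)

/-- The variable x_{k,i} viewed as an element of F. -/
def XF (p : Idx r η) : FF r η := algebraMap (Pol r η) (FF r η) (MvPolynomial.X p)

/-- The element of S_η which transposes (k,i) and (k,j) and fixes all other indices. -/
def transpT (k : Fin r) (i j : Fin (η k)) : Sg r η :=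
  Function.update (1 : Sg r η) k (Equiv.swap i j)

/-- The simple transposition s_i^{(k)}. -/
def simpleT (k : Fin r) (i : ℕ) (h : i + 1 < η k) : Sg r η :=
  transpT r η k ⟨i, Nat.lt_of_succ_lt h⟩ ⟨i + 1, h⟩

/-- The divided difference operator ∂_i^{(k)} on F. -/
def dd (k : Fin r) (i : ℕ) (h : i + 1 < η k) (f : FF r η) : FF r η :=
  (f - actF r η (simpleT r η k i h) f) /
    (XF r η ⟨k, ⟨i, Nat.lt_of_succ_lt h⟩⟩ - XF r η ⟨k, ⟨i + 1, h⟩⟩)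

/-- Data indexing a simple transposition of S_η. -/
abbrev SimpleDat := (k : Fin r) × {i : ℕ // i + 1 < η k}

/-- A word in the simple transpositions of S_η. -/
abbrev Word := List (SimpleDat r η)

/-- The element of S_η represented by a word. -/
def wordPerm (w : Word r η) : Sg r η :=
  (w.map fun s => simpleT r η s.1 s.2.1 s.2.2).prod

/-- The composite ∂_{j_1} ∘ ⋯ ∘ ∂_{j_l} of divided differences along a word. -/
def ddWord (w : Word r η) (f : FF r η) : FF r η :=
  w.foldr (fun s g => dd r η s.1 s.2.1 s.2.2 g) f

/-- The length ℓ(σ): the total number of inversions of σ. -/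
def len (σ : Sg r η) : ℕ :=
  ∑ k : Fin r,
    (Finset.univ.filter fun p : Fin (η k) × Fin (η k) => p.1 < p.2 ∧ σ k p.2 < σ k p.1).card

/-- `w` is a reduced decomposition of σ. -/
def IsRed (σ : Sg r η) (w : Word r η) : Prop :=
  wordPerm r η w = σ ∧ w.length = len r η σ

/-- The longest word w_η of S_η. -/
def wEta : Sg r η := fun _ => Fin.revPerm

/-- η! = η_1! ⋯ η_r!. -/
def etaFact : ℕ := ∏ k : Fin r, Nat.factorial (η k)

/-- The Vandermonde-type product Δ_η as a polynomial. -/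
def DeltaP : Pol r η :=
  ∏ k : Fin r, ∏ p ∈ Finset.univ.filter (fun p : Fin (η k) × Fin (η k) => p.1 < p.2),
    (MvPolynomial.X (⟨k, p.1⟩ : Idx r η) - MvPolynomial.X (⟨k, p.2⟩ : Idx r η))

/-- Δ_η as an element of F. -/
def DeltaF : FF r η := algebraMap (Pol r η) (FF r η) (DeltaP r η)

/-- The symmetrization operator sym_η on F. -/
def symF (f : FF r η) : FF r η :=
  (etaFact r η : FF r η)⁻¹ * ∑ σ : Sg r η, actF r η σ f

/-- The sign of an element of S_η. -/
def sgn (σ : Sg r η) : ℤ := ∏ k : Fin r, (Equiv.Perm.sign (σ k) : ℤ)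

/-- The antisymmetrization operator asym_η on F. -/
def asymF (f : FF r η) : FF r η :=
  (etaFact r η : FF r η)⁻¹ * ∑ σ : Sg r η, (sgn r η σ : FF r η) * actF r η σ f

/-- The ideal p_η of ℂ[X_η] generated by the differences x_{k,i} - x_{k,j}. -/
def pIdeal : Ideal (Pol r η) :=
  Ideal.span {q | ∃ (k : Fin r) (i j : Fin (η k)), i < j ∧
    q = MvPolynomial.X (⟨k, i⟩ : Idx r η) - MvPolynomial.X (⟨k, j⟩ : Idx r η)}

/-! ### The Gelfand–Tsetlin setting: μ = (1,2,…,n) -/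

/-- The composition μ = (1,2,…,n) (0-based: row k has k+1 entries). -/
abbrev mEta (n : ℕ) : Fin n → ℕ := fun k => (k : ℕ) + 1

/-- The index set of Gelfand–Tsetlin tableaux entries. -/
abbrev IdxN (n : ℕ) := Idx n (mEta n)

/-- The polynomial ring ℂ[X_μ]. -/
abbrev PolN (n : ℕ) := Pol n (mEta n)

/-- The field K = ℂ(X_μ). -/
abbrev KK (n : ℕ) := FF n (mEta n)

/-- The group S_μ = S_1 × S_2 × ⋯ × S_n. -/
abbrev SgN (n : ℕ) := Sg n (mEta n)

variable (n : ℕ)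

/-- The additive group ℤ^μ_0 of integral μ-points with vanishing top row. -/
def Z0sub : AddSubgroup (IdxN n → ℤ) where
  carrier := {z | ∀ p : IdxN n, (p.1 : ℕ) + 1 = n → z p = 0}
  add_mem' := by intro a b ha hb p hp; simp [ha p hp, hb p hp]
  zero_mem' := by intro p _; rfl
  neg_mem' := by intro a ha p hp; simp [ha p hp]

abbrev Z0 := ↥(Z0sub n)

/-- The K-vector space V_K with basis {T(z) : z ∈ ℤ^μ_0}. -/
def VK : Type := Z0 n →₀ KK n

instance : AddCommGroup (VK n) := inferInstanceAs (AddCommGroup (Z0 n →₀ KK n))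
instance : Module (KK n) (VK n) := inferInstanceAs (Module (KK n) (Z0 n →₀ KK n))
instance : Module ℂ (VK n) := inferInstanceAs (Module ℂ (Z0 n →₀ KK n))
instance : IsScalarTower ℂ (KK n) (VK n) :=
  inferInstanceAs (IsScalarTower ℂ (KK n) (Z0 n →₀ KK n))
instance : SMulCommClass (KK n) (KK n) (VK n) :=
  inferInstanceAs (SMulCommClass (KK n) (KK n) (Z0 n →₀ KK n))

/-- The tableau T(z), as a basis vector of V_K. -/
def T (z : Z0 n) : VK n := Finsupp.single z 1

/-- The translation automorphism f(x) ↦ f(x+z) of ℂ[X_μ]. -/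
def shiftP (z : IdxN n → ℤ) : PolN n ≃ₐ[ℂ] PolN n :=
  AlgEquiv.ofAlgHom
    (MvPolynomial.aeval fun p => MvPolynomial.X p + MvPolynomial.C ((z p : ℤ) : ℂ))
    (MvPolynomial.aeval fun p => MvPolynomial.X p - MvPolynomial.C ((z p : ℤ) : ℂ))
    (by apply MvPolynomial.algHom_ext; intro p; simp)
    (by apply MvPolynomial.algHom_ext; intro p; simp)

/-- The translation automorphism f(x) ↦ f(x+z) of K = ℂ(X_μ). -/
def shiftK (z : IdxN n → ℤ) : KK n ≃+* KK n :=
  IsFractionRing.ringEquivOfRingEquiv (shiftP n z).toRingEquiv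

/-- The tuple δ^{k,i} ∈ ℤ^μ_0. -/
def deltaZ (k : ℕ) (hk : k + 1 < n) (i : Fin (k + 1)) : Z0 n :=
  ⟨Pi.single (⟨⟨k, Nat.lt_of_succ_lt hk⟩, i⟩ : IdxN n) (1 : ℤ), by
    intro p hp
    rw [Pi.single_apply]
    have : p ≠ (⟨⟨k, Nat.lt_of_succ_lt hk⟩, i⟩ : IdxN n) := by
      intro h; rw [h] at hp; simp at hp; omega
    simp [this]⟩

/-- The Gelfand–Tsetlin function e⁺_{k,i} ∈ K (0-based row k, 0 ≤ k ≤ n-2). -/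
def ePlus (k : ℕ) (hk : k + 1 < n) (i : Fin (k + 1)) : KK n :=
  (∏ j : Fin (k + 2),
      (XF n (mEta n) ⟨⟨k, Nat.lt_of_succ_lt hk⟩, i⟩ - XF n (mEta n) ⟨⟨k + 1, hk⟩, j⟩)) /
  (∏ j ∈ Finset.univ.erase i,
      (XF n (mEta n) ⟨⟨k, Nat.lt_of_succ_lt hk⟩, i⟩ -
        XF n (mEta n) ⟨⟨k, Nat.lt_of_succ_lt hk⟩, j⟩))

/-- The Gelfand–Tsetlin function e⁻_{k,i} ∈ K (0-based row k, 0 ≤ k ≤ n-2). -/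
def eMinus (k : ℕ) (hk : k + 1 < n) (i : Fin (k + 1)) : KK n :=
  (∏ j : Fin k,
      (XF n (mEta n) ⟨⟨k, Nat.lt_of_succ_lt hk⟩, i⟩ -
        XF n (mEta n) ⟨⟨k - 1, by omega⟩, Fin.castLE (by simp only [mEta]; omega) j⟩)) /
  (∏ j ∈ Finset.univ.erase i,
      (XF n (mEta n) ⟨⟨k, Nat.lt_of_succ_lt hk⟩, i⟩ -
        XF n (mEta n) ⟨⟨k, Nat.lt_of_succ_lt hk⟩, j⟩))

/-- The Gelfand–Tsetlin operator E_{k,k+1} (0-based: matrix unit (k, k+1)). -/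
def Eop (k : ℕ) (hk : k + 1 < n) : Module.End (KK n) (VK n) :=
  Finsupp.lsum (KK n) fun z => LinearMap.toSpanSingleton (KK n) (VK n)
    (-∑ i : Fin (k + 1),
      shiftK n (z : IdxN n → ℤ) (ePlus n k hk i) • T n (z + deltaZ n k hk i))

/-- The Gelfand–Tsetlin operator E_{k+1,k} (0-based: matrix unit (k+1, k)). -/
def Fop (k : ℕ) (hk : k + 1 < n) : Module.End (KK n) (VK n) :=
  Finsupp.lsum (KK n) fun z => LinearMap.toSpanSingleton (KK n) (VK n)
    (∑ i : Fin (k + 1),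
      shiftK n (z : IdxN n → ℤ) (eMinus n k hk i) • T n (z - deltaZ n k hk i))

/-- The Gelfand–Tsetlin operator E_{k,k} (0-based row k of the diagonal). -/
def Hop (k : Fin n) : Module.End (KK n) (VK n) :=
  Finsupp.lsum (KK n) fun z => LinearMap.toSpanSingleton (KK n) (VK n)
    (((∑ j : Fin ((k : ℕ) + 1),
        (XF n (mEta n) ⟨k, j⟩ + ((z : IdxN n → ℤ) ⟨k, j⟩ : KK n))) -
      (∑ j : Fin (k : ℕ),
        (XF n (mEta n) ⟨⟨(k : ℕ) - 1, by omega⟩, Fin.castLE (by simp only [mEta]; omega) j⟩ +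
          ((z : IdxN n → ℤ) ⟨⟨(k : ℕ) - 1, by omega⟩, Fin.castLE (by simp only [mEta]; omega) j⟩ : KK n))) +
      ((k : ℕ) : KK n)) • T n z)

/-- The action of S_μ on ℤ^μ_0. -/
def permZ0 (σ : SgN n) : Z0 n ≃ Z0 n where
  toFun z := ⟨fun p => (z : IdxN n → ℤ) ((permIdx n (mEta n) σ).symm p), by
    intro p hp
    exact z.2 ((permIdx n (mEta n) σ).symm p) hp⟩
  invFun z := ⟨fun p => (z : IdxN n → ℤ) (permIdx n (mEta n) σ p), by
    intro p hp
    exact z.2 (permIdx n (mEta n) σ p) hp⟩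
  left_inv z := by ext p; simp
  right_inv z := by ext p; simp

/-- The diagonal action of S_μ on V_K : σ·(f T(z)) = σ(f) T(σ(z)). -/
def sact (σ : SgN n) (w : VK n) : VK n :=
  Finsupp.equivMapDomain (permZ0 n σ) (Finsupp.mapRange (actF n (mEta n) σ) (map_zero _) w)
/-! ### Refinements η of μ, given by a block function on the index set -/

variable (blk : IdxN n → ℕ)

/-- The subgroup S_η ⊆ S_μ of permutations preserving each η-block. -/
def SgEta : Subgroup (SgN n) where
  carrier := {σ | ∀ p : IdxN n, blk (permIdx n (mEta n) σ p) = blk p}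
  one_mem' := fun _ => rfl
  mul_mem' := by
    intro a b ha hb p
    exact (ha (permIdx n (mEta n) b p)).trans (hb p)
  inv_mem' := by
    intro a ha p
    have h := ha (permIdx n (mEta n) a⁻¹ p)
    simpa [permIdx] using h.symm

/-- η! : the order of S_η (the product of the factorials of the parts of η). -/
def etaFactB : ℕ := Nat.card ↥(SgEta n blk)

/-- The symmetrization operator sym_η on K. -/
noncomputable def symK (f : KK n) : KK n :=
  haveI : Fintype ↥(SgEta n blk) := Fintype.ofFinite _
  (etaFactB n blk : KK n)⁻¹ * ∑ τ : ↥(SgEta n blk), actF n (mEta n) (τ : SgN n) f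

/-- The symmetrization operator sym_η on V_K (for the diagonal action). -/
noncomputable def symV (x : VK n) : VK n :=
  haveI : Fintype ↥(SgEta n blk) := Fintype.ofFinite _
  (etaFactB n blk : KK n)⁻¹ • ∑ τ : ↥(SgEta n blk), sact n (τ : SgN n) x

/-- The divided difference operator ∂_i^{(k)} acting on V_K via the diagonal action. -/
noncomputable def ddV (k : Fin n) (i : ℕ) (h : i + 1 < mEta n k) (x : VK n) : VK n :=
  (XF n (mEta n) ⟨k, ⟨i, Nat.lt_of_succ_lt h⟩⟩ - XF n (mEta n) ⟨k, ⟨i + 1, h⟩⟩)⁻¹ •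
    (x - sact n (simpleT n (mEta n) k i h) x)

/-- The composite of divided differences on V_K along a word. -/
noncomputable def ddWordV (w : Word n (mEta n)) (x : VK n) : VK n :=
  w.foldr (fun s g => ddV n s.1 s.2.1 s.2.2 g) x

/-- All letters of the word are simple transpositions inside η-blocks (i.e. lie in S_η). -/
def WordBlk (w : Word n (mEta n)) : Prop :=
  ∀ s ∈ w, blk ⟨s.1, ⟨s.2.1, Nat.lt_of_succ_lt s.2.2⟩⟩ = blk ⟨s.1, ⟨s.2.1 + 1, s.2.2⟩⟩

/-- `w` is a reduced decomposition of σ into simple transpositions of S_η. -/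
def IsRedB (σ : SgN n) (w : Word n (mEta n)) : Prop :=
  IsRed n (mEta n) σ w ∧ WordBlk n blk w

/-- The multiplicative set of ℂ[X_μ] generated by the x_{k,i} − x_{k,j} − c (c a nonzero
integer, row k below the top) and by the x_{k,i} − x_{k,j} with (k,i), (k,j) in different
η-blocks. -/
def BMon : Submonoid (PolN n) :=
  Submonoid.closure
    ({q | ∃ (k : Fin n) (i j : Fin ((k : ℕ) + 1)) (c : ℤ), (k : ℕ) + 1 < n ∧ i < j ∧ c ≠ 0 ∧
        q = MvPolynomial.X (⟨k, i⟩ : IdxN n) - MvPolynomial.X (⟨k, j⟩ : IdxN n) -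
          MvPolynomial.C (c : ℂ)} ∪
     {q | ∃ (k : Fin n) (i j : Fin ((k : ℕ) + 1)), blk ⟨k, i⟩ ≠ blk ⟨k, j⟩ ∧
        q = MvPolynomial.X (⟨k, i⟩ : IdxN n) - MvPolynomial.X (⟨k, j⟩ : IdxN n)})

/-- The algebra B_η ⊆ K : the localization of ℂ[X_μ] at the multiplicative set `BMon`,
viewed as the subalgebra of K of fractions with denominator in `BMon`. -/
def Balg : Subalgebra ℂ (KK n) where
  carrier := {f | ∃ p : PolN n, ∃ q ∈ BMon n blk,
    f * algebraMap (PolN n) (KK n) q = algebraMap (PolN n) (KK n) p}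
  mul_mem' := by
    rintro f g ⟨p₁, q₁, hq₁, h₁⟩ ⟨p₂, q₂, hq₂, h₂⟩
    refine ⟨p₁ * p₂, q₁ * q₂, mul_mem hq₁ hq₂, ?_⟩
    have : f * g * algebraMap (PolN n) (KK n) (q₁ * q₂) =
        (f * algebraMap (PolN n) (KK n) q₁) * (g * algebraMap (PolN n) (KK n) q₂) := by
      rw [map_mul]; ring
    rw [this, h₁, h₂, ← map_mul]
  one_mem' := ⟨1, 1, one_mem _, by simp⟩
  add_mem' := by
    rintro f g ⟨p₁, q₁, hq₁, h₁⟩ ⟨p₂, q₂, hq₂, h₂⟩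
    refine ⟨p₁ * q₂ + p₂ * q₁, q₁ * q₂, mul_mem hq₁ hq₂, ?_⟩
    have : (f + g) * algebraMap (PolN n) (KK n) (q₁ * q₂) =
        (f * algebraMap (PolN n) (KK n) q₁) * algebraMap (PolN n) (KK n) q₂ +
        (g * algebraMap (PolN n) (KK n) q₂) * algebraMap (PolN n) (KK n) q₁ := by
      rw [map_mul]; ring
    rw [this, h₁, h₂, ← map_mul, ← map_mul, ← map_add]
  zero_mem' := ⟨0, 1, one_mem _, by simp⟩
  algebraMap_mem' := by
    intro c
    refine ⟨MvPolynomial.C c, 1, one_mem _, ?_⟩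
    rw [map_one, mul_one, IsScalarTower.algebraMap_apply ℂ (PolN n) (KK n)]
    simp [MvPolynomial.algebraMap_eq]

/-- The set N_η of integral points which are weakly decreasing along each η-block
(normal-form representatives of the S_η-orbits). -/
def Nset : Set (Z0 n) :=
  {z | ∀ (k : Fin n) (i j : Fin ((k : ℕ) + 1)), i ≤ j → blk ⟨k, i⟩ = blk ⟨k, j⟩ →
    (z : IdxN n → ℤ) ⟨k, j⟩ ≤ (z : IdxN n → ℤ) ⟨k, i⟩}

/-- σ is an ε(z)-shuffle: σ ∈ S_η and σ is increasing on each ε(z)-block, where ε(z) is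
the refinement of η whose blocks are the runs of equal entries of z inside the η-blocks
(so S_{ε(z)} is the stabilizer of z in S_η). -/
def IsShuffle (z : Z0 n) (σ : SgN n) : Prop :=
  σ ∈ SgEta n blk ∧
    ∀ (k : Fin n) (i j : Fin ((k : ℕ) + 1)), i < j → blk ⟨k, i⟩ = blk ⟨k, j⟩ →
      (z : IdxN n → ℤ) ⟨k, i⟩ = (z : IdxN n → ℤ) ⟨k, j⟩ → σ k i < σ k j

/-- The index set for the basis of derived tableaux. -/
def BIdx : Type :=
  {x : Z0 n × SgN n // x.1 ∈ Nset n blk ∧ IsShuffle n blk x.1 x.2}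

/-- The operator c_γ on V_K, given by c_γ T(z) = γ(x+z) T(z). -/
noncomputable def copN (γ : PolN n) : Module.End (KK n) (VK n) :=
  Finsupp.lsum (KK n) fun z => LinearMap.toSpanSingleton (KK n) (VK n)
    (shiftK n (z : IdxN n → ℤ) (algebraMap (PolN n) (KK n) γ) • T n z)

/-- Evaluation γ(v+z) of a polynomial at the point v + z. -/
noncomputable def evalVZ (v : IdxN n → ℂ) (z : Z0 n) (γ : PolN n) : ℂ :=
  MvPolynomial.eval (fun p => v p + ((z : IdxN n → ℤ) p : ℂ)) γ

/-! ### The action on polynomials and rational functions -/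

section Action

variable {r η}

theorem actP_X (σ : Sg r η) (p : Idx r η) :
    actP r η σ (MvPolynomial.X p) = MvPolynomial.X (permIdx r η σ p) := by
  simp [actP]

theorem actP_C (σ : Sg r η) (c : ℂ) : actP r η σ (MvPolynomial.C c) = MvPolynomial.C c := by
  simp [actP]

theorem actP_mul (σ τ : Sg r η) (f : Pol r η) :
    actP r η (σ * τ) f = actP r η σ (actP r η τ f) := by
  simp only [actP, AlgEquiv.coe_ringEquiv,
    MvPolynomial.renameEquiv_apply, MvPolynomial.rename_rename]
  rfl

theorem actF_algebraMap (σ : Sg r η) (f : Pol r η) :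
    actF r η σ (algebraMap (Pol r η) (FF r η) f) = algebraMap _ _ (actP r η σ f) :=
  IsFractionRing.ringEquivOfRingEquiv_algebraMap _ _

theorem actF_mul (σ τ : Sg r η) (f : FF r η) :
    actF r η (σ * τ) f = actF r η σ (actF r η τ f) := by
  obtain ⟨a, b, -, rfl⟩ := IsFractionRing.div_surjective (A := Pol r η) f
  simp only [map_div₀, actF_algebraMap, actP_mul]

theorem actP_one (f : Pol r η) : actP r η 1 f = f := by
  refine DFunLike.congr_fun (f := MvPolynomial.rename (R := ℂ) _) (g := AlgHom.id ℂ _) ?_ f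
  exact MvPolynomial.algHom_ext fun p => MvPolynomial.rename_X _ _

theorem actF_one (f : FF r η) : actF r η 1 f = f := by
  obtain ⟨a, b, -, rfl⟩ := IsFractionRing.div_surjective (A := Pol r η) f
  rw [map_div₀, actF_algebraMap, actF_algebraMap, actP_one, actP_one]

theorem actF_XF (σ : Sg r η) (p : Idx r η) :
    actF r η σ (XF r η p) = XF r η (permIdx r η σ p) := by
  rw [XF, actF_algebraMap, actP_X, XF]

theorem permIdx_transpT_left (k : Fin r) (i j : Fin (η k)) :
    permIdx r η (transpT r η k i j) ⟨k, i⟩ = ⟨k, j⟩ := by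
  simp [permIdx, transpT]

theorem permIdx_transpT_right (k : Fin r) (i j : Fin (η k)) :
    permIdx r η (transpT r η k i j) ⟨k, j⟩ = ⟨k, i⟩ := by
  simp [permIdx, transpT]

theorem permIdx_transpT_of_ne (k : Fin r) (i j : Fin (η k)) (p : Idx r η)
    (hi : p ≠ ⟨k, i⟩) (hj : p ≠ ⟨k, j⟩) :
    permIdx r η (transpT r η k i j) p = p := by
  obtain ⟨l, a⟩ := p
  by_cases h : l = k
  · subst h
    simp only [permIdx, transpT, Function.update_self, Equiv.coe_fn_mk]
    rw [Equiv.swap_apply_of_ne_of_ne]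
    · rintro rfl; exact hi rfl
    · rintro rfl; exact hj rfl
  · simp [permIdx, transpT, Function.update_of_ne h]

theorem transpT_mul_self (k : Fin r) (i j : Fin (η k)) :
    transpT r η k i j * transpT r η k i j = 1 := by
  funext l
  by_cases h : l = k
  · subst h; simp [transpT]
  · simp [transpT, Function.update_of_ne h]

theorem sgn_mul (σ τ : Sg r η) : sgn r η (σ * τ) = sgn r η σ * sgn r η τ := by
  simp [sgn, Finset.prod_mul_distrib]

theorem sgn_mul_self (σ : Sg r η) : sgn r η σ * sgn r η σ = 1 := by
  simp only [sgn, ← Finset.prod_mul_distrib]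
  refine Finset.prod_eq_one fun k _ => ?_
  rw [← Units.val_mul, Int.units_mul_self, Units.val_one]

theorem sgn_transpT (k : Fin r) (i j : Fin (η k)) (h : i ≠ j) :
    sgn r η (transpT r η k i j) = -1 := by
  rw [sgn, Finset.prod_eq_single k]
  · simp [transpT, Equiv.Perm.sign_swap h]
  · intro l _ hl
    simp [transpT, Function.update_of_ne hl]
  · simp

theorem actP_DeltaP (σ : Sg r η) :
    actP r η σ (DeltaP r η) = (sgn r η σ : Pol r η) * DeltaP r η := by
  have key (k : Fin r) (f : Fin (η k) → Fin (η k) → Pol r η) :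
      ∏ p ∈ Finset.univ.filter (fun p : Fin (η k) × Fin (η k) => p.1 < p.2), f p.1 p.2 =
        ∏ i, ∏ j ∈ Finset.Ioi i, f i j := by
    rw [Finset.prod_filter, ← Finset.univ_product_univ, Finset.prod_product]
    refine Finset.prod_congr rfl fun i _ => ?_
    rw [← Finset.prod_filter]
    exact Finset.prod_congr (by ext; simp) fun _ _ => rfl
  simp only [DeltaP, map_prod, map_sub, actP_X, sgn, Int.cast_prod, ← Finset.prod_mul_distrib]
  refine Finset.prod_congr rfl fun k _ => ?_
  let f : Fin (η k) → Fin (η k) → Pol r η := fun i j =>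
    MvPolynomial.X ⟨k, i⟩ - MvPolynomial.X ⟨k, j⟩
  refine (key k fun i j => f (σ k i) (σ k j)).trans ?_
  rw [(σ k).prod_Ioi_comp_eq_sign_mul_prod (f := f) fun i j => (neg_sub _ _).symm]
  exact congrArg _ (key k f).symm

theorem actF_DeltaF (σ : Sg r η) :
    actF r η σ (DeltaF r η) = (sgn r η σ : FF r η) * DeltaF r η := by
  rw [DeltaF, actF_algebraMap, actP_DeltaP, map_mul, map_intCast]

theorem X_sub_X_ne_zero {p q : Idx r η} (h : p ≠ q) :
    (MvPolynomial.X p - MvPolynomial.X q : Pol r η) ≠ 0 :=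
  sub_ne_zero.2 fun e => h (MvPolynomial.X_injective e)

theorem DeltaF_ne_zero : DeltaF r η ≠ 0 := by
  rw [DeltaF, Ne, FaithfulSMul.algebraMap_eq_zero_iff, DeltaP, ← Ne, Finset.prod_ne_zero_iff]
  refine fun k _ => Finset.prod_ne_zero_iff.2 fun p hp => X_sub_X_ne_zero fun e => ?_
  have : p.1 < p.2 := by simpa using hp
  exact this.ne (by simpa using e)

/-! ### Divisibility by differences of variables -/

/-- The substitution `x_p ↦ x_q`. -/
def collapse (p q : Idx r η) : Pol r η →ₐ[ℂ] Pol r η :=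
  open Classical in MvPolynomial.aeval fun a => if a = p then MvPolynomial.X q else MvPolynomial.X a

theorem X_sub_X_dvd_iff (p q : Idx r η) (f : Pol r η) :
    (MvPolynomial.X p - MvPolynomial.X q) ∣ f ↔ collapse p q f = 0 := by
  classical
  constructor
  · rintro ⟨g, rfl⟩
    by_cases h : q = p <;> simp [collapse, h]
  · intro h
    rw [← Ideal.mem_span_singleton, ← Ideal.Quotient.eq_zero_iff_mem]
    set I := Ideal.span {(MvPolynomial.X p - MvPolynomial.X q : Pol r η)}
    have : (Ideal.Quotient.mkₐ ℂ I).comp (collapse p q) = Ideal.Quotient.mkₐ ℂ I := by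
      apply MvPolynomial.algHom_ext
      intro a
      by_cases ha : a = p
      · subst ha
        simp only [collapse, AlgHom.comp_apply, MvPolynomial.aeval_X, if_true,
          Ideal.Quotient.mkₐ_eq_mk]
        rw [eq_comm, Ideal.Quotient.eq]
        exact Ideal.mem_span_singleton_self _
      · simp [collapse, ha]
    have h2 := DFunLike.congr_fun this f
    rw [AlgHom.comp_apply, h, map_zero] at h2
    exact h2.symm

theorem X_sub_X_prime {p q : Idx r η} (h : p ≠ q) :
    Prime (MvPolynomial.X p - MvPolynomial.X q : Pol r η) := by
  refine ⟨X_sub_X_ne_zero h, fun hu => ?_, fun a b hab => ?_⟩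
  · have := (X_sub_X_dvd_iff p q 1).1 hu.dvd
    simp at this
  · rw [X_sub_X_dvd_iff, map_mul] at hab
    simpa only [X_sub_X_dvd_iff] using mul_eq_zero.1 hab

theorem X_sub_X_isRelPrime {p q p' q' : Idx r η} (h : p ≠ q) (h' : p' ≠ q')
    (h1 : ¬ (p = p' ∧ q = q')) (h2 : ¬ (p = q' ∧ q = p')) :
    IsRelPrime (MvPolynomial.X p - MvPolynomial.X q : Pol r η)
      (MvPolynomial.X p' - MvPolynomial.X q') := by
  classical
  rw [(X_sub_X_prime h).irreducible.isRelPrime_iff_not_dvd, X_sub_X_dvd_iff]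
  simp only [collapse, map_sub, MvPolynomial.aeval_X]
  split_ifs with a b b <;> rw [sub_eq_zero, MvPolynomial.X_inj] <;> grind

theorem dvd_sub_actP_transpT (k : Fin r) (i j : Fin (η k)) (f : Pol r η) :
    (MvPolynomial.X ⟨k, i⟩ - MvPolynomial.X ⟨k, j⟩) ∣ f - actP r η (transpT r η k i j) f := by
  classical
  rw [X_sub_X_dvd_iff, map_sub, sub_eq_zero]
  have : collapse ⟨k, i⟩ ⟨k, j⟩ = (collapse ⟨k, i⟩ ⟨k, j⟩).comp
      (MvPolynomial.rename (R := ℂ) (permIdx r η (transpT r η k i j))) := by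
    apply MvPolynomial.algHom_ext
    intro p
    rw [AlgHom.comp_apply, MvPolynomial.rename_X]
    by_cases hi : p = ⟨k, i⟩
    · subst hi
      rw [permIdx_transpT_left]
      simp +contextual [collapse]
    by_cases hj : p = ⟨k, j⟩
    · subst hj
      rw [permIdx_transpT_right]
      simp +contextual [collapse]
    rw [permIdx_transpT_of_ne _ _ _ _ hi hj]
  exact DFunLike.congr_fun this f

theorem X_sub_X_dvd_of_antisymm {k : Fin r} {i j : Fin (η k)} {f : Pol r η}
    (h : actP r η (transpT r η k i j) f = -f) :
    (MvPolynomial.X ⟨k, i⟩ - MvPolynomial.X ⟨k, j⟩) ∣ f := by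
  have h1 := dvd_sub_actP_transpT k i j f
  rw [h, sub_neg_eq_add, ← two_mul] at h1
  have h2 : IsUnit (2 : Pol r η) := by
    rw [← map_ofNat (algebraMap ℂ (Pol r η)) 2]
    exact (isUnit_iff_ne_zero.2 two_ne_zero).map _
  exact (h2.dvd_mul_left).1 h1

/-- The signed sum of the translates of a polynomial under a subgroup of `S_η`. -/
def altSum (H : Subgroup (Sg r η)) (f : Pol r η) : Pol r η :=
  open Classical in ∑ τ : H, (sgn r η τ : Pol r η) * actP r η τ f

theorem actP_altSum (H : Subgroup (Sg r η)) (f : Pol r η) {σ : Sg r η} (hσ : σ ∈ H) :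
    actP r η σ (altSum H f) = (sgn r η σ : Pol r η) * altSum H f := by
  classical
  rw [altSum, map_sum, Finset.mul_sum]
  refine Fintype.sum_equiv (Equiv.mulLeft (⟨σ, hσ⟩ : H)) _ _ fun τ => ?_
  rw [Equiv.coe_mulLeft, Subgroup.coe_mul, actP_mul, sgn_mul, map_mul, map_intCast, ← mul_assoc]
  push_cast
  rw [← mul_assoc, ← Int.cast_mul (sgn r η σ), sgn_mul_self, Int.cast_one, one_mul]

theorem altSum_transpT {H : Subgroup (Sg r η)} (f : Pol r η) {k : Fin r} {i j : Fin (η k)}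
    (hij : i ≠ j) (h : transpT r η k i j ∈ H) :
    actP r η (transpT r η k i j) (altSum H f) = -altSum H f := by
  rw [actP_altSum H f h, sgn_transpT k i j hij]
  simp

end Action

/-! ### The diagonal action on `V_K` -/

section Diagonal

variable {n blk}

theorem smul_T (f : KK n) (z : Z0 n) : f • T n z = (Finsupp.single z f : Z0 n →₀ KK n) :=
  Finsupp.smul_single_one z f

theorem VK_induction {p : VK n → Prop} (hadd : ∀ x y, p x → p y → p (x + y))
    (hT : ∀ (f : KK n) (z : Z0 n), p (f • T n z)) (w : VK n) : p w := by
  refine Finsupp.induction_linear (motive := p) w ?_ (fun x y => hadd x y) fun z f => ?_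
  · have := hT 0 0
    rwa [zero_smul] at this
  · rw [← smul_T]
    exact hT f z

theorem sact_add (σ : SgN n) (x y : VK n) : sact n σ (x + y) = sact n σ x + sact n σ y :=
  Finsupp.ext fun _ => map_add (actF n (mEta n) σ) _ _

theorem sact_smul (σ : SgN n) (f : KK n) (x : VK n) :
    sact n σ (f • x) = actF n (mEta n) σ f • sact n σ x :=
  Finsupp.ext fun _ => map_mul (actF n (mEta n) σ) _ _

theorem sact_T (σ : SgN n) (z : Z0 n) : sact n σ (T n z) = T n (permZ0 n σ z) := by
  change Finsupp.equivMapDomain (permZ0 n σ)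
    (Finsupp.mapRange (actF n (mEta n) σ) (map_zero _) (Finsupp.single z 1)) = Finsupp.single _ 1
  rw [Finsupp.mapRange_single, Finsupp.equivMapDomain_single, map_one]

theorem permZ0_mul (σ τ : SgN n) (z : Z0 n) :
    permZ0 n (σ * τ) z = permZ0 n σ (permZ0 n τ z) := rfl

/-- The diagonal action of an element of `S_μ` as an additive map. -/
def sactHom (σ : SgN n) : VK n →+ VK n := AddMonoidHom.mk' (sact n σ) (sact_add σ)

theorem sact_zero (σ : SgN n) : sact n σ 0 = 0 := (sactHom σ).map_zero

theorem sact_sub (σ : SgN n) (x y : VK n) : sact n σ (x - y) = sact n σ x - sact n σ y :=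
  (sactHom σ).map_sub x y

theorem sact_sum {ι : Type*} (σ : SgN n) (s : Finset ι) (f : ι → VK n) :
    sact n σ (∑ i ∈ s, f i) = ∑ i ∈ s, sact n σ (f i) := map_sum (sactHom σ) f s

theorem sact_mul (σ τ : SgN n) (x : VK n) : sact n (σ * τ) x = sact n σ (sact n τ x) := by
  induction x using VK_induction with
  | hadd x y hx hy => simp only [sact_add, hx, hy]
  | hT f z => simp only [sact_smul, sact_T, actF_mul, permZ0_mul]

theorem sact_one (x : VK n) : sact n 1 x = x := by
  have h : sact n 1 (sact n 1 x) = sact n 1 x := by rw [← sact_mul, one_mul]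
  have hinj : Function.Injective (sact n (1 : SgN n)) := fun a b hab => by
    refine Finsupp.ext fun z => (actF n (mEta n) 1).injective ?_
    exact DFunLike.congr_fun (F := Z0 n →₀ KK n) hab z
  exact hinj h

/-! ### Symmetrization -/

instance : Fintype ↥(SgEta n blk) := Fintype.ofFinite _

theorem symV_def (x : VK n) :
    symV n blk x = (etaFactB n blk : KK n)⁻¹ • ∑ τ : SgEta n blk, sact n (τ : SgN n) x := rfl

theorem etaFactB_ne_zero : (etaFactB n blk : KK n) ≠ 0 :=
  Nat.cast_ne_zero.2 Nat.card_pos.ne'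

theorem symV_add (x y : VK n) : symV n blk (x + y) = symV n blk x + symV n blk y := by
  simp only [symV_def, sact_add, Finset.sum_add_distrib, smul_add]

/-- The symmetrization operator as an additive map. -/
def symHom (n : ℕ) (blk : IdxN n → ℕ) : VK n →+ VK n := AddMonoidHom.mk' (symV n blk) symV_add

theorem symV_sub (x y : VK n) : symV n blk (x - y) = symV n blk x - symV n blk y :=
  (symHom n blk).map_sub x y

theorem symV_sum {ι : Type*} (s : Finset ι) (f : ι → VK n) :
    symV n blk (∑ i ∈ s, f i) = ∑ i ∈ s, symV n blk (f i) := map_sum (symHom n blk) f s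

theorem sact_symV {σ : SgN n} (hσ : σ ∈ SgEta n blk) (x : VK n) :
    sact n σ (symV n blk x) = symV n blk x := by
  rw [symV_def, sact_smul, map_inv₀, map_natCast, sact_sum]
  refine congrArg _ ?_
  refine Fintype.sum_equiv (Equiv.mulLeft (⟨σ, hσ⟩ : SgEta n blk)) _ _ fun τ => ?_
  rw [Equiv.coe_mulLeft, Subgroup.coe_mul, sact_mul]

theorem symV_sact {σ : SgN n} (hσ : σ ∈ SgEta n blk) (x : VK n) :
    symV n blk (sact n σ x) = symV n blk x := by
  rw [symV_def, symV_def]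
  refine congrArg _ ?_
  refine Fintype.sum_equiv (Equiv.mulRight (⟨σ, hσ⟩ : SgEta n blk)) _ _ fun τ => ?_
  rw [Equiv.coe_mulRight, Subgroup.coe_mul, sact_mul]

theorem symV_smul_of_invariant (f : KK n) {x : VK n}
    (hx : ∀ σ ∈ SgEta n blk, sact n σ x = x) :
    symV n blk (f • x) = symK n blk f • x := by
  rw [symV_def, symK, mul_smul, Finset.sum_smul]
  refine congrArg _ ?_
  exact Finset.sum_congr rfl fun τ _ => by rw [sact_smul, hx _ τ.2]

theorem map_symV (A : Module.End (KK n) (VK n))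
    (hA : ∀ (σ : SgN n) (x : VK n), A (sact n σ x) = sact n σ (A x)) (x : VK n) :
    A (symV n blk x) = symV n blk (A x) := by
  simp only [symV_def, map_smul, map_sum, hA]

theorem symK_mul_of_invariant (f : KK n) {g : KK n}
    (hg : ∀ σ ∈ SgEta n blk, actF n (mEta n) σ g = g) :
    symK n blk (f * g) = symK n blk f * g := by
  rw [symK, symK, mul_assoc, Finset.sum_mul]
  refine congrArg _ ?_
  exact Finset.sum_congr rfl fun τ _ => by rw [map_mul, hg _ τ.2]

/-! ### Transpositions inside a block -/

theorem transpT_mem_SgEta {k : Fin n} {i j : Fin (mEta n k)} (h : blk ⟨k, i⟩ = blk ⟨k, j⟩) :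
    transpT n (mEta n) k i j ∈ SgEta n blk := by
  intro p
  by_cases hi : p = ⟨k, i⟩
  · rw [hi, permIdx_transpT_left, h]
  by_cases hj : p = ⟨k, j⟩
  · rw [hj, permIdx_transpT_right, h]
  rw [permIdx_transpT_of_ne _ _ _ _ hi hj]

theorem permZ0_transpT {z : Z0 n} {k : Fin n} {i j : Fin (mEta n k)}
    (h : (z : IdxN n → ℤ) ⟨k, i⟩ = (z : IdxN n → ℤ) ⟨k, j⟩) :
    permZ0 n (transpT n (mEta n) k i j) z = z := by
  have h1 : ∀ p, (z : IdxN n → ℤ) (permIdx n (mEta n) (transpT n (mEta n) k i j) p) =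
      (z : IdxN n → ℤ) p := by
    intro p
    by_cases hi : p = ⟨k, i⟩
    · rw [hi, permIdx_transpT_left, h]
    by_cases hj : p = ⟨k, j⟩
    · rw [hj, permIdx_transpT_right, h]
    rw [permIdx_transpT_of_ne _ _ _ _ hi hj]
  refine Subtype.ext (funext fun p => ?_)
  have h2 := h1 ((permIdx n (mEta n) (transpT n (mEta n) k i j)).symm p)
  rw [Equiv.apply_symm_apply] at h2
  exact h2.symm

/-! ### Divided differences on `V_K` -/

theorem simpleT_mul_self (k : Fin n) (i : ℕ) (h : i + 1 < mEta n k) :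
    simpleT n (mEta n) k i h * simpleT n (mEta n) k i h = 1 := transpT_mul_self _ _ _

/-- The simple root `x_{k,i} - x_{k,i+1}`. -/
def rootP (k : Fin n) (i : ℕ) (h : i + 1 < mEta n k) : PolN n :=
  MvPolynomial.X ⟨k, ⟨i, Nat.lt_of_succ_lt h⟩⟩ - MvPolynomial.X ⟨k, ⟨i + 1, h⟩⟩

theorem rootP_ne_zero (k : Fin n) (i : ℕ) (h : i + 1 < mEta n k) :
    algebraMap (PolN n) (KK n) (rootP k i h) ≠ 0 := by
  rw [Ne, FaithfulSMul.algebraMap_eq_zero_iff]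
  exact X_sub_X_ne_zero (by simp)

theorem actP_rootP (k : Fin n) (i : ℕ) (h : i + 1 < mEta n k) :
    actP n (mEta n) (simpleT n (mEta n) k i h) (rootP k i h) = -rootP k i h := by
  rw [rootP, map_sub, actP_X, actP_X, simpleT, permIdx_transpT_left, permIdx_transpT_right, neg_sub]

theorem ddV_def (k : Fin n) (i : ℕ) (h : i + 1 < mEta n k) (x : VK n) :
    ddV n k i h x = (algebraMap (PolN n) (KK n) (rootP k i h))⁻¹ •
      (x - sact n (simpleT n (mEta n) k i h) x) := by
  rw [ddV, rootP, map_sub]; rfl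

theorem sact_ddV (k : Fin n) (i : ℕ) (h : i + 1 < mEta n k) (x : VK n) :
    sact n (simpleT n (mEta n) k i h) (ddV n k i h x) = ddV n k i h x := by
  rw [ddV_def, sact_smul, map_inv₀, actF_algebraMap, actP_rootP, map_neg, sact_sub, ← sact_mul,
    simpleT_mul_self, sact_one, ← neg_sub x, smul_neg]
  generalize algebraMap (PolN n) (KK n) (rootP k i h) = a
  have h1 : (-a)⁻¹ = -a⁻¹ := inv_neg
  rw [h1, neg_smul, neg_neg]

theorem ddV_ddV (k : Fin n) (i : ℕ) (h : i + 1 < mEta n k) (x : VK n) :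
    ddV n k i h (ddV n k i h x) = 0 := by
  rw [ddV_def _ _ _ (ddV n k i h x), sact_ddV, sub_self, smul_zero]

theorem ddV_zero (k : Fin n) (i : ℕ) (h : i + 1 < mEta n k) : ddV n k i h 0 = 0 := by
  rw [ddV_def, sact_zero, sub_zero, smul_zero]

theorem rootP_smul_ddV (k : Fin n) (i : ℕ) (h : i + 1 < mEta n k) (x : VK n) :
    algebraMap (PolN n) (KK n) (rootP k i h) • ddV n k i h x =
      x - sact n (simpleT n (mEta n) k i h) x := by
  rw [ddV_def, smul_inv_smul₀ (rootP_ne_zero k i h)]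

theorem div_neg_mul_inv_neg {F : Type*} [Field F] (a b c : F) :
    a / -b * (-c)⁻¹ = a / b * c⁻¹ := by
  rw [div_neg, inv_neg, neg_mul_neg]

theorem mul_div_mul_inv_cancel {F : Type*} [Field F] {a : F} (ha : a ≠ 0) (b c : F) :
    a * b / c * a⁻¹ = b / c := by
  field_simp

/-- Moving a divided difference across the symmetrization operator. -/
theorem exists_symV_ddV {k : Fin n} {i : ℕ} (h : i + 1 < mEta n k)
    (hb : simpleT n (mEta n) k i h ∈ SgEta n blk) (g : PolN n) :
    ∃ g' : PolN n, ∀ x : VK n,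
      symV n blk ((algebraMap _ (KK n) g / DeltaF n (mEta n)) • ddV n k i h x) =
        symV n blk ((algebraMap _ (KK n) g' / DeltaF n (mEta n)) • x) := by
  obtain ⟨g', hg'⟩ := dvd_sub_actP_transpT (r := n) (η := mEta n) k
    ⟨i, Nat.lt_of_succ_lt h⟩ ⟨i + 1, h⟩ g
  refine ⟨g', fun x => ?_⟩
  have hα := rootP_ne_zero k i h
  have hΔ := DeltaF_ne_zero (r := n) (η := mEta n)
  set α := algebraMap (PolN n) (KK n) (rootP k i h) with hαdef
  set s := simpleT n (mEta n) k i h with hs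
  set Δ := DeltaF n (mEta n)
  set c : KK n := algebraMap _ (KK n) g / Δ * α⁻¹ with hc
  have hsc : actF n (mEta n) s c = algebraMap _ (KK n) (actP n (mEta n) s g) / Δ * α⁻¹ := by
    have hα' : actF n (mEta n) s α = -α := by
      rw [hαdef, actF_algebraMap, actP_rootP, map_neg]
    have hΔ' : actF n (mEta n) s Δ = -Δ := by
      rw [actF_DeltaF, hs, simpleT, sgn_transpT _ _ _ (by simp), Int.cast_neg, Int.cast_one]
      exact neg_one_mul _
    rw [hc, map_mul, map_div₀, map_inv₀, actF_algebraMap, hα', hΔ']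
    exact div_neg_mul_inv_neg _ _ _
  have h1 : c • sact n s x = sact n s (actF n (mEta n) s c • x) := by
    rw [sact_smul, ← actF_mul, simpleT_mul_self]
    rw [actF_one]
  have hcg : c - actF n (mEta n) s c = algebraMap _ (KK n) g' / Δ := by
    have h2 : algebraMap (PolN n) (KK n) g - algebraMap _ (KK n) (actP n (mEta n) s g) =
        α * algebraMap _ (KK n) g' := by
      rw [← map_sub, ← map_mul]
      exact congrArg _ hg'
    rw [hc, hsc, ← sub_mul, ← sub_div, h2]
    exact mul_div_mul_inv_cancel hα _ _
  rw [ddV_def, smul_smul, ← hαdef, ← hc, smul_sub, symV_sub, h1, symV_sact hb, ← symV_sub,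
    ← sub_smul, hcg]

theorem exists_symV_ddWordV {w : Word n (mEta n)} (hw : WordBlk n blk w) (g : PolN n) :
    ∃ g' : PolN n, ∀ x : VK n,
      symV n blk ((algebraMap _ (KK n) g / DeltaF n (mEta n)) • ddWordV n w x) =
        symV n blk ((algebraMap _ (KK n) g' / DeltaF n (mEta n)) • x) := by
  induction w generalizing g with
  | nil => exact ⟨g, fun x => rfl⟩
  | cons s w ih =>
    obtain ⟨g₁, h₁⟩ := exists_symV_ddV s.2.2
      (transpT_mem_SgEta (hw s (List.mem_cons_self ..))) g
    obtain ⟨g₂, h₂⟩ := ih (fun t ht => hw t (List.mem_cons_of_mem _ ht)) g₁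
    exact ⟨g₂, fun x => (h₁ _).trans (h₂ x)⟩

end Diagonal

/-! ### Lengths and reduced words -/

section Length

variable {r η n blk}

theorem card_inversions_swap_mul {m i : ℕ} (h : i + 1 < m) (π : Equiv.Perm (Fin m))
    (hπ : π.symm ⟨i, Nat.lt_of_succ_lt h⟩ < π.symm ⟨i + 1, h⟩) :
    (Finset.univ.filter fun p : Fin m × Fin m => p.1 < p.2 ∧
      (Equiv.swap (⟨i, Nat.lt_of_succ_lt h⟩ : Fin m) ⟨i + 1, h⟩ * π) p.2 <
        (Equiv.swap (⟨i, Nat.lt_of_succ_lt h⟩ : Fin m) ⟨i + 1, h⟩ * π) p.1).card =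
    (Finset.univ.filter fun p : Fin m × Fin m => p.1 < p.2 ∧ π p.2 < π p.1).card + 1 := by
  set u : Fin m := ⟨i, Nat.lt_of_succ_lt h⟩ with hu
  set v : Fin m := ⟨i + 1, h⟩ with hv
  have key : ∀ a b : Fin m, ¬ (a = u ∧ b = v) → ¬ (a = v ∧ b = u) →
      (Equiv.swap u v b < Equiv.swap u v a ↔ b < a) := by
    intro a b h1 h2
    simp only [Equiv.swap_apply_def]
    simp only [hu, hv, Fin.ext_iff, Fin.lt_def] at *
    split_ifs <;> simp <;> omega
  rw [← Finset.card_insert_of_notMem (a := (π.symm u, π.symm v))]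
  · congr 1
    ext ⟨a, b⟩
    rw [Finset.mem_insert, Finset.mem_filter, Finset.mem_filter, Prod.mk.injEq,
      and_iff_right (Finset.mem_univ _), and_iff_right (Finset.mem_univ _)]
    change (a < b ∧ Equiv.swap u v (π b) < Equiv.swap u v (π a)) ↔ _ ∨ (a < b ∧ π b < π a)
    by_cases h1 : π a = u ∧ π b = v
    · have ha : a = π.symm u := by rw [← h1.1, Equiv.symm_apply_apply]
      have hb : b = π.symm v := by rw [← h1.2, Equiv.symm_apply_apply]
      subst ha hb
      refine iff_of_true ⟨hπ, ?_⟩ (Or.inl ⟨rfl, rfl⟩)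
      rw [Equiv.apply_symm_apply, Equiv.apply_symm_apply, Equiv.swap_apply_right,
        Equiv.swap_apply_left]
      exact Nat.lt_succ_self i
    · have h1' : ¬ (a = π.symm u ∧ b = π.symm v) := by
        rintro ⟨rfl, rfl⟩
        simp at h1
      by_cases h2 : π a = v ∧ π b = u
      · have ha : a = π.symm v := by rw [← h2.1, Equiv.symm_apply_apply]
        have hb : b = π.symm u := by rw [← h2.2, Equiv.symm_apply_apply]
        subst ha hb
        have := hπ.not_gt
        simp_all
      · rw [key _ _ h1 h2]
        tauto
  · simp only [Finset.mem_filter, Finset.mem_univ, true_and, Equiv.apply_symm_apply, not_and]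
    simp [hu, hv]

theorem len_simpleT_mul_of_lt (σ : Sg r η) {k : Fin r} {i : ℕ} (h : i + 1 < η k)
    (hσ : (σ k).symm ⟨i, Nat.lt_of_succ_lt h⟩ < (σ k).symm ⟨i + 1, h⟩) :
    len r η (simpleT r η k i h * σ) = len r η σ + 1 := by
  rw [len, len, ← Finset.add_sum_erase _ _ (Finset.mem_univ k),
    ← Finset.add_sum_erase _ _ (Finset.mem_univ k)]
  have h1 := card_inversions_swap_mul h (σ k) hσ
  have h2 : (simpleT r η k i h * σ) k =
      Equiv.swap ⟨i, Nat.lt_of_succ_lt h⟩ ⟨i + 1, h⟩ * σ k := by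
    simp [simpleT, transpT]
  rw [h2, h1, add_right_comm]
  congr 2
  refine Finset.sum_congr rfl fun l hl => ?_
  have h3 : (simpleT r η k i h * σ) l = σ l := by
    simp [simpleT, transpT, Function.update_of_ne (Finset.ne_of_mem_erase hl)]
  rw [h3]

theorem len_simpleT_mul_of_gt (σ : Sg r η) {k : Fin r} {i : ℕ} (h : i + 1 < η k)
    (hσ : (σ k).symm ⟨i + 1, h⟩ < (σ k).symm ⟨i, Nat.lt_of_succ_lt h⟩) :
    len r η (simpleT r η k i h * σ) + 1 = len r η σ := by
  rw [← len_simpleT_mul_of_lt (simpleT r η k i h * σ) h, ← mul_assoc]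
  · rw [simpleT, transpT_mul_self, one_mul]
  · have h2 : ((simpleT r η k i h * σ) k).symm =
        (Equiv.swap ⟨i, Nat.lt_of_succ_lt h⟩ ⟨i + 1, h⟩).trans (σ k).symm := by
      rw [show (simpleT r η k i h * σ) k =
        Equiv.swap ⟨i, Nat.lt_of_succ_lt h⟩ ⟨i + 1, h⟩ * σ k by simp [simpleT, transpT]]
      rfl
    rw [h2]
    simpa using hσ

theorem wordPerm_cons (s : SimpleDat r η) (w : Word r η) :
    wordPerm r η (s :: w) = simpleT r η s.1 s.2.1 s.2.2 * wordPerm r η w := by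
  simp [wordPerm]

theorem WordBlk.tail {s : SimpleDat n (mEta n)} {w : Word n (mEta n)}
    (h : WordBlk n blk (s :: w)) : WordBlk n blk w :=
  fun t ht => h t (List.mem_cons_of_mem _ ht)

theorem WordBlk.head {s : SimpleDat n (mEta n)} {w : Word n (mEta n)}
    (h : WordBlk n blk (s :: w)) : simpleT n (mEta n) s.1 s.2.1 s.2.2 ∈ SgEta n blk :=
  transpT_mem_SgEta (h s List.mem_cons_self)

theorem WordBlk.cons {s : SimpleDat n (mEta n)} {w : Word n (mEta n)}
    (hs : blk ⟨s.1, ⟨s.2.1, Nat.lt_of_succ_lt s.2.2⟩⟩ = blk ⟨s.1, ⟨s.2.1 + 1, s.2.2⟩⟩)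
    (h : WordBlk n blk w) : WordBlk n blk (s :: w) := by
  intro t ht
  rcases List.mem_cons.1 ht with rfl | ht
  · exact hs
  · exact h t ht

theorem wordPerm_mem {w : Word n (mEta n)} (h : WordBlk n blk w) :
    wordPerm n (mEta n) w ∈ SgEta n blk := by
  induction w with
  | nil => exact one_mem _
  | cons s w ih =>
    rw [wordPerm_cons]
    exact mul_mem h.head (ih h.tail)

theorem len_one : len r η 1 = 0 := by
  refine Finset.sum_eq_zero fun k _ => Finset.card_eq_zero.2 (Finset.filter_eq_empty_iff.2 ?_)
  rintro p - ⟨h1, h2⟩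
  exact h1.not_gt h2

theorem exists_isRedB (hmono : ∀ k : Fin n, Monotone fun i : Fin ((k : ℕ) + 1) => blk ⟨k, i⟩)
    {σ : SgN n} (hσ : σ ∈ SgEta n blk) : ∃ w, IsRedB n blk σ w := by
  induction hl : len n (mEta n) σ using Nat.strong_induction_on generalizing σ with
  | _ l ih =>
    by_cases hd : ∃ (k : Fin n) (i : ℕ) (h : i + 1 < mEta n k),
        (σ k).symm ⟨i + 1, h⟩ < (σ k).symm ⟨i, Nat.lt_of_succ_lt h⟩
    · obtain ⟨k, i, h, hlt⟩ := hd
      have hblk : ∀ a : Fin (mEta n k), blk ⟨k, (σ k).symm a⟩ = blk ⟨k, a⟩ := fun a => by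
        have := hσ ⟨k, (σ k).symm a⟩
        rw [← this]
        simp [permIdx]
      have hb : blk ⟨k, ⟨i, Nat.lt_of_succ_lt h⟩⟩ = blk ⟨k, ⟨i + 1, h⟩⟩ := by
        refine le_antisymm (hmono k (Fin.mk_le_mk.2 (Nat.le_succ i))) ?_
        rw [← hblk, ← hblk ⟨i, _⟩]
        exact hmono k hlt.le
      have hlen := len_simpleT_mul_of_gt σ h hlt
      have hs : simpleT n (mEta n) k i h ∈ SgEta n blk := transpT_mem_SgEta hb
      obtain ⟨w, ⟨hw1, hw2⟩, hw3⟩ := ih _ (by omega) (mul_mem hs hσ) rfl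
      refine ⟨⟨k, i, h⟩ :: w, ⟨?_, ?_⟩, WordBlk.cons hb hw3⟩
      · rw [wordPerm_cons, hw1]
        change simpleT n (mEta n) k i h * (simpleT n (mEta n) k i h * σ) = σ
        rw [← mul_assoc, simpleT_mul_self, one_mul]
      · rw [List.length_cons, hw2, ← hlen]
    · push Not at hd
      have h1 : σ = 1 := by
        funext k
        have hm : Monotone (σ k).symm := Fin.monotone_iff_le_succ.2 fun i =>
          hd k i (Nat.succ_lt_succ i.2)
        have hs : StrictMono (σ k).symm := hm.strictMono_of_injective (σ k).symm.injective
        have he : (σ k).symm = 1 := Equiv.ext fun a => by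
          have h3 : ((σ k).symm : Fin (mEta n k) → Fin (mEta n k)) = id :=
            hs.range_inj strictMono_id |>.1 (by simp)
          exact congrFun h3 a
        rw [← Equiv.symm_symm (σ k), he]
        rfl
      subst h1
      exact ⟨[], ⟨rfl, len_one.symm⟩, fun s hs => by simp at hs⟩

theorem isRed_or_ddWordV_eq_zero
    (hmono : ∀ k : Fin n, Monotone fun i : Fin ((k : ℕ) + 1) => blk ⟨k, i⟩)
    {PdV : SgN n → VK n → VK n}
    (hPdV : ∀ σ ∈ SgEta n blk, ∀ w : Word n (mEta n), IsRedB n blk σ w →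
      ∀ x : VK n, PdV σ x = ddWordV n w x)
    {w : Word n (mEta n)} (hw : WordBlk n blk w) :
    IsRedB n blk (wordPerm n (mEta n) w) w ∨ ∀ x, ddWordV n w x = 0 := by
  induction w with
  | nil => exact Or.inl ⟨⟨rfl, len_one.symm⟩, hw⟩
  | cons s w ih =>
    rcases ih hw.tail with hred | h0
    · set σ := wordPerm n (mEta n) w
      have hσ : σ ∈ SgEta n blk := wordPerm_mem hw.tail
      obtain ⟨k, i, h⟩ := s
      rcases lt_or_gt_of_ne (a := (σ k).symm ⟨i, Nat.lt_of_succ_lt h⟩)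
        (b := (σ k).symm ⟨i + 1, h⟩) (fun e => by simpa using (σ k).symm.injective e) with hlt | hgt
      · refine Or.inl ⟨⟨rfl, ?_⟩, hw⟩
        rw [wordPerm_cons, List.length_cons, hred.1.2]
        exact (len_simpleT_mul_of_lt σ h hlt).symm
      · refine Or.inr fun x => ?_
        have hlen := len_simpleT_mul_of_gt σ h hgt
        obtain ⟨w', ⟨hw1, hw2⟩, hw3⟩ := exists_isRedB hmono (mul_mem hw.head hσ)
        have hred' : IsRedB n blk σ (⟨k, i, h⟩ :: w') := by
          refine ⟨⟨?_, ?_⟩, WordBlk.cons (hw _ List.mem_cons_self) hw3⟩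
          · rw [wordPerm_cons, hw1]
            change simpleT n (mEta n) k i h * (simpleT n (mEta n) k i h * σ) = σ
            rw [← mul_assoc, simpleT_mul_self, one_mul]
          · rw [List.length_cons, hw2, ← hlen]
        have h1 : ddWordV n w x = ddV n k i h (ddWordV n w' x) :=
          (hPdV σ hσ w hred x).symm.trans (hPdV σ hσ _ hred' x)
        change ddV n k i h (ddWordV n w x) = 0
        rw [h1, ddV_ddV]
    · refine Or.inr fun x => ?_
      change ddV n s.1 s.2.1 s.2.2 (ddWordV n w x) = 0
      rw [h0, ddV_zero]

theorem len_le (σ : Sg r η) : len r η σ ≤ ∑ k : Fin r, Fintype.card (Fin (η k) × Fin (η k)) :=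
  Finset.sum_le_sum fun _ _ => Finset.card_le_univ _

/-- The generators of `L_η`. -/
def latticeGens (n : ℕ) (blk : IdxN n → ℕ) (PdV : SgN n → VK n → VK n) : Set (VK n) :=
  {x : VK n | ∃ σ ∈ SgEta n blk, ∃ z : Z0 n, x = symV n blk (PdV σ (T n z))}

/-- The lattice `L_η`. -/
abbrev lattice (n : ℕ) (blk : IdxN n → ℕ) (PdV : SgN n → VK n → VK n) :
    Submodule ↥(Balg n blk) (VK n) := Submodule.span _ (latticeGens n blk PdV)

theorem algebraMap_mem_Balg (f : PolN n) : algebraMap (PolN n) (KK n) f ∈ Balg n blk :=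
  ⟨f, 1, one_mem _, by rw [map_one, mul_one]⟩

theorem smul_mem_of_mem_Balg {L : Submodule ↥(Balg n blk) (VK n)} {b : KK n}
    (hb : b ∈ Balg n blk) {x : VK n} (hx : x ∈ L) : b • x ∈ L :=
  L.smul_mem (⟨b, hb⟩ : Balg n blk) hx

theorem natCast_inv_mem_Balg (m : ℕ) : (m : KK n)⁻¹ ∈ Balg n blk := by
  have h : (m : KK n)⁻¹ = algebraMap ℂ (KK n) (m : ℂ)⁻¹ := by
    rw [map_inv₀, map_natCast]
  rw [h]
  exact Subalgebra.algebraMap_mem _ _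

theorem natCast_smul_mem_iff {L : Submodule ↥(Balg n blk) (VK n)} {m : ℕ} (hm : m ≠ 0)
    {x : VK n} : (m : KK n) • x ∈ L ↔ x ∈ L := by
  refine ⟨fun h => ?_, fun h => smul_mem_of_mem_Balg (natCast_mem _ m) h⟩
  have h3 := smul_mem_of_mem_Balg (natCast_inv_mem_Balg m) h
  rwa [inv_smul_smul₀ (Nat.cast_ne_zero.2 hm)] at h3

theorem symV_ddWordV_mem
    (hmono : ∀ k : Fin n, Monotone fun i : Fin ((k : ℕ) + 1) => blk ⟨k, i⟩)
    {PdV : SgN n → VK n → VK n}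
    (hPdV : ∀ σ ∈ SgEta n blk, ∀ w : Word n (mEta n), IsRedB n blk σ w →
      ∀ x : VK n, PdV σ x = ddWordV n w x)
    {w : Word n (mEta n)} (hw : WordBlk n blk w) (z : Z0 n) :
    symV n blk (ddWordV n w (T n z)) ∈ lattice n blk PdV := by
  rcases isRed_or_ddWordV_eq_zero hmono hPdV hw with h | h
  · exact Submodule.subset_span ⟨_, wordPerm_mem hw, z, by rw [hPdV _ (wordPerm_mem hw) w h]⟩
  · have h0 : symV n blk 0 = 0 := (symHom n blk).map_zero
    rw [h, h0]
    exact zero_mem _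

/-- All elements `ρ (∂_w T(z))` lie in the lattice. -/
theorem sact_ddWordV_mem
    (hmono : ∀ k : Fin n, Monotone fun i : Fin ((k : ℕ) + 1) => blk ⟨k, i⟩)
    {PdV : SgN n → VK n → VK n}
    (hPdV : ∀ σ ∈ SgEta n blk, ∀ w : Word n (mEta n), IsRedB n blk σ w →
      ∀ x : VK n, PdV σ x = ddWordV n w x)
    (z : Z0 n) {w : Word n (mEta n)} (hw : WordBlk n blk w) {ρ : SgN n} (hρ : ρ ∈ SgEta n blk) :
    sact n ρ (ddWordV n w (T n z)) ∈ lattice n blk PdV := by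
  set N := ∑ k : Fin n, Fintype.card (Fin (mEta n k) × Fin (mEta n k))
  induction hd : N + 1 - w.length generalizing w ρ with
  | zero =>
    rcases isRed_or_ddWordV_eq_zero hmono hPdV hw with h | h
    · have h1 := h.1.2
      have h2 := len_le (wordPerm n (mEta n) w)
      omega
    · rw [h, sact_zero]
      exact zero_mem _
  | succ d ih =>
    set y := ddWordV n w (T n z)
    have step : ∀ ρ ∈ SgEta n blk, ∀ s : SimpleDat n (mEta n), WordBlk n blk [s] →
        sact n (ρ * simpleT n (mEta n) s.1 s.2.1 s.2.2) y - sact n ρ y ∈ lattice n blk PdV := by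
      intro ρ hρ s hs
      have h1 := ih (w := s :: w) (ρ := ρ) (WordBlk.cons (hs s List.mem_cons_self) hw) hρ
        (by rw [List.length_cons]; omega)
      have h2 := smul_mem_of_mem_Balg (algebraMap_mem_Balg (blk := blk)
        (actP n (mEta n) ρ (rootP s.1 s.2.1 s.2.2))) h1
      rw [← actF_algebraMap, ← sact_smul] at h2
      change sact n ρ (_ • ddV n s.1 s.2.1 s.2.2 y) ∈ _ at h2
      rw [rootP_smul_ddV, sact_sub, ← sact_mul] at h2
      rw [← neg_sub]
      exact neg_mem h2
    have all : ∀ v : Word n (mEta n), WordBlk n blk v → ∀ ρ ∈ SgEta n blk,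
        sact n (ρ * wordPerm n (mEta n) v) y - sact n ρ y ∈ lattice n blk PdV := by
      intro v hv
      induction v with
      | nil =>
        intro ρ _
        have : wordPerm n (mEta n) ([] : Word n (mEta n)) = 1 := rfl
        rw [this, mul_one, sub_self]
        exact zero_mem _
      | cons s v ihv =>
        intro ρ hρ
        have h1 := ihv hv.tail _ (mul_mem hρ hv.head)
        have h2 := step ρ hρ s (WordBlk.cons (hv s List.mem_cons_self) fun t ht => by simp at ht)
        rw [wordPerm_cons, ← mul_assoc]
        have h3 := add_mem h1 h2
        rwa [sub_add_sub_cancel] at h3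
    have all' : ∀ τ ∈ SgEta n blk, sact n τ y - y ∈ lattice n blk PdV := by
      intro τ hτ
      obtain ⟨v, ⟨hv, -⟩, hv'⟩ := exists_isRedB hmono hτ
      have h1 := all v hv' 1 (one_mem _)
      rwa [one_mul, hv, sact_one] at h1
    have hy : y ∈ lattice n blk PdV := by
      rw [← natCast_smul_mem_iff (m := etaFactB n blk) Nat.card_pos.ne']
      have h1 := (natCast_smul_mem_iff (m := etaFactB n blk) Nat.card_pos.ne').2
        (symV_ddWordV_mem hmono hPdV hw z)
      rw [symV_def, smul_inv_smul₀ etaFactB_ne_zero] at h1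
      have h2 : ∑ τ : SgEta n blk, (sact n (τ : SgN n) y - y) ∈ lattice n blk PdV :=
        sum_mem fun τ _ => all' τ τ.2
      rw [Finset.sum_sub_distrib, Finset.sum_const, Finset.card_univ, ← Nat.card_eq_fintype_card,
        ← Nat.cast_smul_eq_nsmul (KK n)] at h2
      have h3 := sub_mem h1 h2
      rwa [sub_sub_cancel] at h3
    have h1 := add_mem (all' ρ hρ) hy
    rwa [sub_add_cancel] at h1

theorem T_mem_lattice
    (hmono : ∀ k : Fin n, Monotone fun i : Fin ((k : ℕ) + 1) => blk ⟨k, i⟩)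
    {PdV : SgN n → VK n → VK n}
    (hPdV : ∀ σ ∈ SgEta n blk, ∀ w : Word n (mEta n), IsRedB n blk σ w →
      ∀ x : VK n, PdV σ x = ddWordV n w x)
    (z : Z0 n) : T n z ∈ lattice n blk PdV := by
  have h := sact_ddWordV_mem hmono hPdV z (w := []) (fun s hs => by simp at hs)
    (one_mem (SgEta n blk))
  rwa [sact_one] at h

end Length

/-! ### Units of `B_η` and the symmetrization operator -/

section Units

variable {n blk}

theorem inv_mem_Balg_of_mem_BMon {q : PolN n} (hq : q ∈ BMon n blk) :
    (algebraMap (PolN n) (KK n) q)⁻¹ ∈ Balg n blk := by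
  by_cases h : algebraMap (PolN n) (KK n) q = 0
  · rw [h, inv_zero]
    exact zero_mem _
  · exact ⟨1, q, hq, by rw [inv_mul_cancel₀ h, map_one]⟩

theorem inv_neg_mem_Balg {f : KK n} (h : f⁻¹ ∈ Balg n blk) : (-f)⁻¹ ∈ Balg n blk := by
  rw [show (-f)⁻¹ = -f⁻¹ from inv_neg]
  exact neg_mem h

theorem inv_mul_mem_Balg {f g : KK n} (hf : f⁻¹ ∈ Balg n blk) (hg : g⁻¹ ∈ Balg n blk) :
    (f * g)⁻¹ ∈ Balg n blk := by
  rw [show (f * g)⁻¹ = f⁻¹ * g⁻¹ from mul_inv f g]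
  exact mul_mem hf hg

theorem inv_prod_mem_Balg {ι : Type*} (s : Finset ι) (f : ι → KK n)
    (h : ∀ i ∈ s, (f i)⁻¹ ∈ Balg n blk) : (∏ i ∈ s, f i)⁻¹ ∈ Balg n blk := by
  rw [← Finset.prod_inv_distrib]
  exact prod_mem h

theorem inv_X_sub_X_mem_Balg {k : Fin n} {i j : Fin ((k : ℕ) + 1)}
    (h : blk ⟨k, i⟩ ≠ blk ⟨k, j⟩) :
    (algebraMap (PolN n) (KK n) (MvPolynomial.X ⟨k, i⟩ - MvPolynomial.X ⟨k, j⟩))⁻¹ ∈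
      Balg n blk :=
  inv_mem_Balg_of_mem_BMon (Submonoid.subset_closure (Or.inr ⟨k, i, j, h, rfl⟩))

theorem inv_X_sub_X_sub_C_mem_Balg {k : Fin n} (hk : (k : ℕ) + 1 < n)
    {i j : Fin ((k : ℕ) + 1)} (hij : i ≠ j) {c : ℤ} (hc : c ≠ 0) :
    (algebraMap (PolN n) (KK n) (MvPolynomial.X ⟨k, i⟩ - MvPolynomial.X ⟨k, j⟩ -
      MvPolynomial.C (c : ℂ)))⁻¹ ∈ Balg n blk := by
  rcases lt_or_gt_of_ne hij with h | h
  · exact inv_mem_Balg_of_mem_BMon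
      (Submonoid.subset_closure (Or.inl ⟨k, i, j, c, hk, h, hc, rfl⟩))
  · have h1 : (MvPolynomial.X ⟨k, i⟩ - MvPolynomial.X ⟨k, j⟩ - MvPolynomial.C (c : ℂ) : PolN n) =
        -(MvPolynomial.X ⟨k, j⟩ - MvPolynomial.X ⟨k, i⟩ - MvPolynomial.C ((-c : ℤ) : ℂ)) := by
      rw [Int.cast_neg, MvPolynomial.C_neg]
      ring
    rw [h1, map_neg]
    exact inv_neg_mem_Balg (inv_mem_Balg_of_mem_BMon
      (Submonoid.subset_closure (Or.inl ⟨k, j, i, -c, hk, h, neg_ne_zero.2 hc, rfl⟩)))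

theorem inv_actP_mem_Balg {σ : SgN n} (hσ : σ ∈ SgEta n blk) {q : PolN n} (hq : q ∈ BMon n blk) :
    (algebraMap (PolN n) (KK n) (actP n (mEta n) σ q))⁻¹ ∈ Balg n blk := by
  induction hq using Submonoid.closure_induction with
  | mem q hq =>
    rcases hq with ⟨k, i, j, c, hk, hij, hc, rfl⟩ | ⟨k, i, j, h, rfl⟩
    · rw [map_sub (actP n (mEta n) σ), map_sub (actP n (mEta n) σ), actP_X, actP_X, actP_C]
      exact inv_X_sub_X_sub_C_mem_Balg hk (fun e => hij.ne ((σ k).injective e)) hc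
    · rw [map_sub, actP_X, actP_X]
      refine inv_X_sub_X_mem_Balg fun e => h ?_
      rw [← hσ ⟨k, i⟩, ← hσ ⟨k, j⟩]
      exact e
  | one =>
    rw [map_one, map_one, inv_one]
    exact one_mem _
  | mul a b _ _ ha hb =>
    rw [map_mul, map_mul]
    exact inv_mul_mem_Balg ha hb

theorem ne_zero_of_mem_BMon {q : PolN n} (hq : q ∈ BMon n blk) : q ≠ 0 := by
  induction hq using Submonoid.closure_induction with
  | mem q hq =>
    rcases hq with ⟨k, i, j, c, hk, hij, hc, rfl⟩ | ⟨k, i, j, h, rfl⟩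
    · intro h
      have h1 := congrArg (MvPolynomial.eval 0) h
      simp [hc] at h1
    · exact X_sub_X_ne_zero fun e => h (congrArg blk e)
  | one => exact one_ne_zero
  | mul a b _ _ ha hb => exact mul_ne_zero ha hb

theorem mul_div_mul_cancel_eq {F : Type*} [Field F] {a b : F} (ha : a ≠ 0) (c : F) :
    a * c / (a * b) = c * b⁻¹ := by
  rw [mul_div_mul_left _ _ ha, div_eq_mul_inv]

theorem div_DeltaF_mem_Balg {f : PolN n}
    (hf : ∀ (k : Fin n) (i j : Fin (mEta n k)), i ≠ j → blk ⟨k, i⟩ = blk ⟨k, j⟩ →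
      actP n (mEta n) (transpT n (mEta n) k i j) f = -f) :
    algebraMap (PolN n) (KK n) f / DeltaF n (mEta n) ∈ Balg n blk := by
  set S : Finset ((k : Fin n) × (Fin (mEta n k) × Fin (mEta n k))) :=
    Finset.univ.sigma fun k => Finset.univ.filter fun p => p.1 < p.2 with hS
  let g : (k : Fin n) × (Fin (mEta n k) × Fin (mEta n k)) → PolN n := fun s =>
    MvPolynomial.X ⟨s.1, s.2.1⟩ - MvPolynomial.X ⟨s.1, s.2.2⟩
  have hlt : ∀ s ∈ S, s.2.1 < s.2.2 := fun s hs => by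
    simpa using (Finset.mem_sigma.1 hs).2
  let P : (k : Fin n) × (Fin (mEta n k) × Fin (mEta n k)) → Prop := fun s =>
    blk ⟨s.1, s.2.1⟩ = blk ⟨s.1, s.2.2⟩
  have hD : DeltaP n (mEta n) = (∏ s ∈ S with P s, g s) * ∏ s ∈ S with ¬ P s, g s := by
    rw [Finset.prod_filter_mul_prod_filter_not, hS, Finset.prod_sigma]
    rfl
  have h1 : (∏ s ∈ S with P s, g s) ∣ f := by
    refine Finset.prod_dvd_of_isRelPrime ?_ ?_
    · rintro ⟨k, i, j⟩ hs ⟨l, a, b⟩ ht hne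
      have hs1 := hlt _ (Finset.mem_filter.1 hs).1
      have ht1 := hlt _ (Finset.mem_filter.1 ht).1
      refine X_sub_X_isRelPrime ?_ ?_ ?_ ?_
      · intro e
        exact hs1.ne (by simpa using e)
      · intro e
        exact ht1.ne (by simpa using e)
      · rintro ⟨e1, e2⟩
        cases e1
        cases e2
        exact hne rfl
      · rintro ⟨e1, e2⟩
        cases e1
        cases e2
        exact hs1.not_gt ht1
    · rintro ⟨k, i, j⟩ hs
      exact X_sub_X_dvd_of_antisymm
        (hf k i j (hlt _ (Finset.mem_filter.1 hs).1).ne (Finset.mem_filter.1 hs).2)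
  obtain ⟨c, rfl⟩ := h1
  have h0 : algebraMap (PolN n) (KK n) (∏ s ∈ S with P s, g s) ≠ 0 := by
    rw [Ne, FaithfulSMul.algebraMap_eq_zero_iff, ← Ne, Finset.prod_ne_zero_iff]
    rintro ⟨k, i, j⟩ hs
    refine X_sub_X_ne_zero fun e => ?_
    exact (hlt _ (Finset.mem_filter.1 hs).1).ne (by simpa using e)
  rw [DeltaF, hD, map_mul, map_mul,
    show ∀ a b c : KK n, a ≠ 0 → a * c / (a * b) = c * b⁻¹ from
      fun a b c ha => mul_div_mul_cancel_eq ha c]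
  · refine mul_mem (algebraMap_mem_Balg c) ?_
    rw [map_prod]
    exact inv_prod_mem_Balg _ _ fun s hs => inv_X_sub_X_mem_Balg (Finset.mem_filter.1 hs).2
  · exact h0

theorem div_intCast_mul_of_mul_self {F : Type*} [Field F] {s : ℤ} (hs : s * s = 1) (a b : F) :
    a / ((s : F) * b) = (s : F) * a / b := by
  have h1 : (s : F) * s = 1 := by exact_mod_cast congrArg (Int.cast : ℤ → F) hs
  rw [div_mul_eq_div_div, div_eq_mul_inv a, inv_eq_of_mul_eq_one_left h1,
    mul_comm a]

theorem actF_div_DeltaF (σ : SgN n) (f : PolN n) :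
    actF n (mEta n) σ (algebraMap (PolN n) (KK n) f / DeltaF n (mEta n)) =
      algebraMap (PolN n) (KK n) ((sgn n (mEta n) σ : PolN n) * actP n (mEta n) σ f) /
        DeltaF n (mEta n) := by
  rw [map_div₀, actF_algebraMap, actF_DeltaF, map_mul, map_intCast]
  exact div_intCast_mul_of_mul_self (sgn_mul_self σ) _ _

theorem altSum_SgEta (f : PolN n) :
    altSum (SgEta n blk) f =
      ∑ τ : SgEta n blk, (sgn n (mEta n) τ : PolN n) * actP n (mEta n) τ f := by
  unfold altSum
  congr!

theorem symK_div_DeltaF (f : PolN n) :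
    symK n blk (algebraMap (PolN n) (KK n) f / DeltaF n (mEta n)) =
      (etaFactB n blk : KK n)⁻¹ *
        (algebraMap (PolN n) (KK n) (altSum (SgEta n blk) f) / DeltaF n (mEta n)) := by
  rw [symK, altSum_SgEta, map_sum, Finset.sum_div]
  exact congrArg _ (Finset.sum_congr rfl fun τ _ => actF_div_DeltaF _ _)

theorem div_mul_eq_mul_div_of_mul_eq {F : Type*} [Field F] {b q p : F} (h : b * q = p) (q' d : F) :
    b / d * (q * q') = p * q' / d := by
  rw [← h]; ring

theorem symK_div_DeltaF_mem_Balg {b : KK n} (hb : b ∈ Balg n blk) :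
    symK n blk (b / DeltaF n (mEta n)) ∈ Balg n blk := by
  classical
  obtain ⟨p, q, hq, h⟩ := hb
  set Q : PolN n := ∏ τ : SgEta n blk, actP n (mEta n) (τ : SgN n) q with hQ
  have hQ1 : Q = q * ∏ τ ∈ (Finset.univ : Finset (SgEta n blk)).erase 1,
      actP n (mEta n) (τ : SgN n) q := by
    rw [hQ, ← Finset.mul_prod_erase _ _ (Finset.mem_univ (1 : SgEta n blk)), Subgroup.coe_one,
      actP_one]
  have hQ0 : algebraMap (PolN n) (KK n) Q ≠ 0 := by
    rw [Ne, FaithfulSMul.algebraMap_eq_zero_iff, ← Ne, hQ, Finset.prod_ne_zero_iff]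
    intro τ _
    rw [Ne, map_eq_zero_iff _ (actP n (mEta n) (τ : SgN n)).injective]
    exact ne_zero_of_mem_BMon hq
  have hQinv : (algebraMap (PolN n) (KK n) Q)⁻¹ ∈ Balg n blk := by
    rw [hQ, map_prod]
    exact inv_prod_mem_Balg _ _ fun τ _ => inv_actP_mem_Balg τ.2 hq
  have hQG : ∀ σ ∈ SgEta n blk, actF n (mEta n) σ (algebraMap (PolN n) (KK n) Q) =
      algebraMap (PolN n) (KK n) Q := by
    intro σ hσ
    rw [actF_algebraMap, hQ, map_prod]
    refine congrArg _ (Fintype.prod_equiv (Equiv.mulLeft (⟨σ, hσ⟩ : SgEta n blk)) _ _ fun τ => ?_)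
    rw [Equiv.coe_mulLeft, Subgroup.coe_mul, actP_mul]
  have h1 : symK n blk (b / DeltaF n (mEta n)) * algebraMap (PolN n) (KK n) Q ∈ Balg n blk := by
    rw [← symK_mul_of_invariant _ hQG, hQ1, map_mul,
      div_mul_eq_mul_div_of_mul_eq h, ← map_mul, symK_div_DeltaF]
    refine mul_mem (natCast_inv_mem_Balg _) (div_DeltaF_mem_Balg fun k i j hij hb => ?_)
    exact altSum_transpT _ hij (transpT_mem_SgEta hb)
  have h2 := mul_mem h1 hQinv
  rwa [mul_inv_cancel_right₀ hQ0] at h2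

theorem symV_div_DeltaF_smul_mem {PdV : SgN n → VK n → VK n} {x : VK n}
    (hx : x ∈ lattice n blk PdV) {b : KK n} (hb : b ∈ Balg n blk) :
    symV n blk ((b / DeltaF n (mEta n)) • x) ∈ lattice n blk PdV := by
  induction hx using Submodule.span_induction generalizing b with
  | mem x hx =>
    obtain ⟨σ, hσ, z, rfl⟩ := hx
    rw [symV_smul_of_invariant _ fun τ hτ => sact_symV hτ _]
    exact smul_mem_of_mem_Balg (symK_div_DeltaF_mem_Balg hb)
      (Submodule.subset_span ⟨σ, hσ, z, rfl⟩)
  | zero =>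
    have h0 : symV n blk 0 = 0 := (symHom n blk).map_zero
    rw [smul_zero, h0]
    exact zero_mem _
  | add x y _ _ ihx ihy =>
    rw [smul_add, symV_add]
    exact add_mem (ihx hb) (ihy hb)
  | smul a x _ ih =>
    have h := ih (mul_mem hb a.2)
    rwa [show (b * (a : KK n) / DeltaF n (mEta n)) = b / DeltaF n (mEta n) * (a : KK n) from
      mul_div_right_comm _ _ _, mul_smul] at h

end Units

/-! ### A stability criterion -/

section Criterion

variable {n blk}

theorem permZ0_one (z : Z0 n) : permZ0 n 1 z = z := rfl

/-- The stabilizer of `z` in `S_η`. -/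
def stabZ (blk : IdxN n → ℕ) (z : Z0 n) : Subgroup (SgN n) where
  carrier := {τ | τ ∈ SgEta n blk ∧ permZ0 n τ z = z}
  one_mem' := ⟨one_mem _, rfl⟩
  mul_mem' := fun {a b} ha hb => ⟨mul_mem ha.1 hb.1, by rw [permZ0_mul, hb.2, ha.2]⟩
  inv_mem' := fun {a} ha => ⟨inv_mem ha.1, by
    conv_lhs => rw [← ha.2]
    rw [← permZ0_mul, inv_mul_cancel, permZ0_one]⟩

/-- A polynomial is alternating at `z` if it changes sign under all transpositions of `S_η`
which fix `z`. -/
def IsAltAt (blk : IdxN n → ℕ) (z : Z0 n) (h : PolN n) : Prop :=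
  ∀ (k : Fin n) (i j : Fin (mEta n k)), i ≠ j → blk ⟨k, i⟩ = blk ⟨k, j⟩ →
    (z : IdxN n → ℤ) ⟨k, i⟩ = (z : IdxN n → ℤ) ⟨k, j⟩ →
    actP n (mEta n) (transpT n (mEta n) k i j) h = -h

theorem isAltAt_altSum (z : Z0 n) (h : PolN n) : IsAltAt blk z (altSum (stabZ blk z) h) :=
  fun _ _ _ hij hb hz => altSum_transpT h hij ⟨transpT_mem_SgEta hb, permZ0_transpT hz⟩

theorem symV_altSum (z : Z0 n) (h : PolN n) :
    symV n blk ((algebraMap (PolN n) (KK n) (altSum (stabZ blk z) h) / DeltaF n (mEta n)) •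
      T n z) =
    (Nat.card (stabZ blk z) : KK n) •
      symV n blk ((algebraMap (PolN n) (KK n) h / DeltaF n (mEta n)) • T n z) := by
  classical
  rw [altSum, map_sum, Finset.sum_div, Finset.sum_smul, symV_sum,
    Finset.sum_congr rfl (g := fun _ =>
      symV n blk ((algebraMap (PolN n) (KK n) h / DeltaF n (mEta n)) • T n z))]
  · rw [Finset.sum_const, Finset.card_univ, Nat.card_eq_fintype_card, Nat.cast_smul_eq_nsmul]
  · intro τ _
    rw [← actF_div_DeltaF]
    have h1 : T n z = sact n (τ : SgN n) (T n z) := by rw [sact_T, τ.2.2]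
    conv_lhs => rw [h1]
    rw [← sact_smul, symV_sact τ.2.1]

theorem map_mem_lattice
    (hmono : ∀ k : Fin n, Monotone fun i : Fin ((k : ℕ) + 1) => blk ⟨k, i⟩)
    {PdV : SgN n → VK n → VK n}
    (hPdV : ∀ σ ∈ SgEta n blk, ∀ w : Word n (mEta n), IsRedB n blk σ w →
      ∀ x : VK n, PdV σ x = ddWordV n w x)
    (O : Module.End (KK n) (VK n))
    (hO : ∀ (σ : SgN n) (x : VK n), O (sact n σ x) = sact n σ (O x))
    (hT : ∀ (z : Z0 n) (h : PolN n), IsAltAt blk z h →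
      algebraMap (PolN n) (KK n) h • O (T n z) ∈
        Submodule.span ↥(Balg n blk) (Set.range (T n)))
    {w : VK n} (hw : w ∈ lattice n blk PdV) : O w ∈ lattice n blk PdV := by
  induction hw using Submodule.span_induction with
  | mem x hx =>
    obtain ⟨σ, hσ, z, rfl⟩ := hx
    obtain ⟨v, hv⟩ := exists_isRedB hmono hσ
    obtain ⟨h, hh⟩ := exists_symV_ddWordV hv.2 (DeltaP n (mEta n))
    have h1 := hh (T n z)
    rw [← DeltaF, div_self DeltaF_ne_zero, one_smul, ← hPdV σ hσ v hv] at h1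
    rw [h1, ← natCast_smul_mem_iff (m := Nat.card (stabZ blk z)) Nat.card_pos.ne', ← map_smul,
      ← symV_altSum, map_symV O hO, map_smul,
      show ∀ a d : KK n, a / d = 1 / d * a from fun a d => by rw [one_div_mul_eq_div], mul_smul]
    refine symV_div_DeltaF_smul_mem ?_ (one_mem _)
    refine Submodule.span_le.2 ?_ (hT z _ (isAltAt_altSum z h))
    rintro _ ⟨z', rfl⟩
    exact T_mem_lattice hmono hPdV z'
  | zero =>
    rw [map_zero]
    exact zero_mem _
  | add x y _ _ ihx ihy =>
    rw [map_add]
    exact add_mem ihx ihy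
  | smul a x _ ih =>
    change O ((a : KK n) • x) ∈ _
    rw [map_smul]
    exact smul_mem_of_mem_Balg a.2 ih

end Criterion

/-! ### Translations and equivariance -/

section Operators

variable {n blk}

theorem shiftP_X (z : IdxN n → ℤ) (p : IdxN n) :
    shiftP n z (MvPolynomial.X p) = MvPolynomial.X p + MvPolynomial.C ((z p : ℤ) : ℂ) := by
  simp [shiftP]

theorem shiftP_C (z : IdxN n → ℤ) (c : ℂ) :
    shiftP n z (MvPolynomial.C c) = MvPolynomial.C c :=
  (shiftP n z).commutes c

theorem shiftK_algebraMap (z : IdxN n → ℤ) (f : PolN n) :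
    shiftK n z (algebraMap (PolN n) (KK n) f) = algebraMap _ _ (shiftP n z f) :=
  IsFractionRing.ringEquivOfRingEquiv_algebraMap _ _

theorem shiftP_actP (σ : SgN n) (z : Z0 n) (f : PolN n) :
    shiftP n (permZ0 n σ z : IdxN n → ℤ) (actP n (mEta n) σ f) =
      actP n (mEta n) σ (shiftP n (z : IdxN n → ℤ) f) := by
  induction f using MvPolynomial.induction_on with
  | C c => rw [actP_C, shiftP_C, shiftP_C, actP_C]
  | add p q hp hq => simp only [map_add, hp, hq]
  | mul_X p a hp =>
    rw [map_mul, map_mul, map_mul, map_mul, hp, actP_X, shiftP_X, shiftP_X, map_add, actP_X, actP_C]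
    simp [permZ0]

theorem shiftK_actF (σ : SgN n) (z : Z0 n) (f : KK n) :
    shiftK n (permZ0 n σ z : IdxN n → ℤ) (actF n (mEta n) σ f) =
      actF n (mEta n) σ (shiftK n (z : IdxN n → ℤ) f) := by
  obtain ⟨a, b, -, rfl⟩ := IsFractionRing.div_surjective (A := PolN n) f
  simp only [map_div₀, actF_algebraMap, shiftK_algebraMap, shiftP_actP]

theorem permZ0_add (σ : SgN n) (z z' : Z0 n) :
    permZ0 n σ (z + z') = permZ0 n σ z + permZ0 n σ z' := rfl

theorem permZ0_deltaZ (σ : SgN n) (k : ℕ) (hk : k + 1 < n) (i : Fin (k + 1)) :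
    permZ0 n σ (deltaZ n k hk i) = deltaZ n k hk (σ ⟨k, Nat.lt_of_succ_lt hk⟩ i) := by
  refine Subtype.ext (funext fun p => ?_)
  change (Pi.single _ (1 : ℤ) : IdxN n → ℤ) ((permIdx n (mEta n) σ).symm p) =
    (Pi.single _ (1 : ℤ) : IdxN n → ℤ) p
  rw [Pi.single_apply, Pi.single_apply]
  refine if_congr ?_ rfl rfl
  rw [Equiv.symm_apply_eq]
  rfl

theorem map_sact_of_shift {ι : Type*} [Fintype ι] (O : Module.End (KK n) (VK n))
    (c : ι → KK n) (d : ι → Z0 n) (e : SgN n → Equiv.Perm ι)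
    (hO : ∀ z : Z0 n, O (T n z) = ∑ i, shiftK n (z : IdxN n → ℤ) (c i) • T n (z + d i))
    (hc : ∀ σ i, actF n (mEta n) σ (c i) = c (e σ i))
    (hd : ∀ σ i, permZ0 n σ (d i) = d (e σ i)) (σ : SgN n) (x : VK n) :
    O (sact n σ x) = sact n σ (O x) := by
  induction x using VK_induction with
  | hadd x y hx hy => simp only [sact_add, map_add, hx, hy]
  | hT f z =>
    rw [sact_smul, map_smul, map_smul, sact_smul, sact_T, hO, hO, sact_sum]
    refine congrArg _ (Fintype.sum_equiv (e σ) _ _ fun i => ?_).symm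
    rw [sact_smul, sact_T, ← shiftK_actF, hc, permZ0_add, hd]

theorem mul_mul_div_mul_eq {F : Type*} [Field F] {a b : F} (ha : a ≠ 0) (c p : F) :
    a * c * (p / (a * b)) = c * p * b⁻¹ := by
  rw [mul_assoc, ← mul_div_assoc, ← mul_div_assoc, mul_div_mul_left _ _ ha, ← div_eq_mul_inv]

theorem mul_shiftK_div_mem_Balg {z : Z0 n} {h : PolN n} (hh : IsAltAt blk z h)
    {k : Fin n} (hk : (k : ℕ) + 1 < n) (i : Fin (mEta n k)) (f : PolN n) :
    algebraMap (PolN n) (KK n) h * shiftK n (z : IdxN n → ℤ) (algebraMap (PolN n) (KK n) f /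
      ∏ j ∈ Finset.univ.erase i, (XF n (mEta n) ⟨k, i⟩ - XF n (mEta n) ⟨k, j⟩)) ∈ Balg n blk := by
  set zz : IdxN n → ℤ := (z : IdxN n → ℤ)
  let g : Fin (mEta n k) → PolN n := fun j => MvPolynomial.X ⟨k, i⟩ - MvPolynomial.X ⟨k, j⟩ -
    MvPolynomial.C ((zz ⟨k, j⟩ - zz ⟨k, i⟩ : ℤ) : ℂ)
  let P : Fin (mEta n k) → Prop := fun j =>
    blk ⟨k, i⟩ = blk ⟨k, j⟩ ∧ zz ⟨k, i⟩ = zz ⟨k, j⟩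
  have hg : ∀ j, zz ⟨k, i⟩ = zz ⟨k, j⟩ →
      g j = MvPolynomial.X ⟨k, i⟩ - MvPolynomial.X ⟨k, j⟩ := fun j hj => by
    simp [g, hj]
  have hne : ∀ j ∈ Finset.univ.erase i, (⟨k, i⟩ : IdxN n) ≠ ⟨k, j⟩ := fun j hj e =>
    Finset.ne_of_mem_erase hj (by simpa using e.symm)
  have h1 : shiftK n zz (algebraMap (PolN n) (KK n) f /
      ∏ j ∈ Finset.univ.erase i, (XF n (mEta n) ⟨k, i⟩ - XF n (mEta n) ⟨k, j⟩)) =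
      algebraMap (PolN n) (KK n) (shiftP n zz f) /
        (algebraMap (PolN n) (KK n) (∏ j ∈ Finset.univ.erase i with P j, g j) *
          algebraMap (PolN n) (KK n) (∏ j ∈ Finset.univ.erase i with ¬ P j, g j)) := by
    rw [← map_mul, Finset.prod_filter_mul_prod_filter_not, map_div₀, shiftK_algebraMap, map_prod,
      map_prod]
    refine congrArg _ (Finset.prod_congr rfl fun j _ => ?_)
    rw [XF, XF, ← map_sub, shiftK_algebraMap, map_sub, shiftP_X, shiftP_X]
    refine congrArg _ ?_
    simp only [g, Int.cast_sub, MvPolynomial.C_sub]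
    ring
  have h2 : (∏ j ∈ Finset.univ.erase i with P j, g j) ∣ h := by
    refine Finset.prod_dvd_of_isRelPrime ?_ ?_
    · intro j hj l hl hjl
      have hj' := Finset.mem_filter.1 hj
      have hl' := Finset.mem_filter.1 hl
      change IsRelPrime (g j) (g l)
      rw [hg j hj'.2.2, hg l hl'.2.2]
      refine X_sub_X_isRelPrime (hne j hj'.1) (hne l hl'.1) ?_ ?_
      · rintro ⟨-, e⟩
        exact hjl (by simpa using e)
      · rintro ⟨e, -⟩
        exact hne l hl'.1 e
    · intro j hj
      have hj' := Finset.mem_filter.1 hj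
      rw [hg j hj'.2.2]
      exact X_sub_X_dvd_of_antisymm
        (hh k i j (Finset.ne_of_mem_erase hj'.1).symm hj'.2.1 hj'.2.2)
  obtain ⟨c, rfl⟩ := h2
  have h0 : algebraMap (PolN n) (KK n) (∏ j ∈ Finset.univ.erase i with P j, g j) ≠ 0 := by
    rw [Ne, FaithfulSMul.algebraMap_eq_zero_iff, ← Ne, Finset.prod_ne_zero_iff]
    intro j hj
    have hj' := Finset.mem_filter.1 hj
    rw [hg j hj'.2.2]
    exact X_sub_X_ne_zero (hne j hj'.1)
  rw [h1, map_mul, show ∀ a b c p : KK n, a ≠ 0 → a * c * (p / (a * b)) = c * p * b⁻¹ from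
    fun a b c p ha => mul_mul_div_mul_eq ha c p]
  · refine mul_mem (mul_mem (algebraMap_mem_Balg c) (algebraMap_mem_Balg _)) ?_
    rw [map_prod]
    refine inv_prod_mem_Balg _ _ fun j hj => ?_
    have hj' := Finset.mem_filter.1 hj
    by_cases hz : zz ⟨k, i⟩ = zz ⟨k, j⟩
    · rw [hg j hz]
      exact inv_X_sub_X_mem_Balg fun e => hj'.2 ⟨e, hz⟩
    · exact inv_X_sub_X_sub_C_mem_Balg hk (Finset.ne_of_mem_erase hj'.1).symm
        (sub_ne_zero.2 fun e => hz e.symm)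
  · exact h0

theorem sum_smul_T_mem_span {ι : Type*} [Fintype ι] (f : KK n) (c : ι → KK n) (d : ι → Z0 n)
    (hc : ∀ i, f * c i ∈ Balg n blk) :
    f • ∑ i, c i • T n (d i) ∈ Submodule.span ↥(Balg n blk) (Set.range (T n)) := by
  rw [Finset.smul_sum]
  refine sum_mem fun i _ => ?_
  rw [← mul_smul]
  exact smul_mem_of_mem_Balg (hc i) (Submodule.subset_span ⟨d i, rfl⟩)

theorem Eop_T (k : ℕ) (hk : k + 1 < n) (z : Z0 n) :
    Eop n k hk (T n z) = -∑ i : Fin (k + 1),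
      shiftK n (z : IdxN n → ℤ) (ePlus n k hk i) • T n (z + deltaZ n k hk i) :=
  (Finsupp.lsum_single _ _ _ _).trans (one_smul _ _)

theorem Fop_T (k : ℕ) (hk : k + 1 < n) (z : Z0 n) :
    Fop n k hk (T n z) = ∑ i : Fin (k + 1),
      shiftK n (z : IdxN n → ℤ) (eMinus n k hk i) • T n (z - deltaZ n k hk i) :=
  (Finsupp.lsum_single _ _ _ _).trans (one_smul _ _)

/-- The numerator of `-e⁺_{k,i}`. -/
def numPlus (k : ℕ) (hk : k + 1 < n) (i : Fin (k + 1)) : PolN n :=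
  -∏ j : Fin (k + 2), (MvPolynomial.X ⟨⟨k, Nat.lt_of_succ_lt hk⟩, i⟩ -
    MvPolynomial.X ⟨⟨k + 1, hk⟩, j⟩)

/-- The numerator of `e⁻_{k,i}`. -/
def numMinus (k : ℕ) (hk : k + 1 < n) (i : Fin (k + 1)) : PolN n :=
  ∏ j : Fin k, (MvPolynomial.X ⟨⟨k, Nat.lt_of_succ_lt hk⟩, i⟩ -
    MvPolynomial.X ⟨⟨k - 1, by omega⟩, Fin.castLE (by simp only [mEta]; omega) j⟩)

/-- The polynomial `∑ x_{k,j} - ∑ x_{k-1,j} + k`. -/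
def weightP (k : Fin n) : PolN n :=
  (∑ j : Fin ((k : ℕ) + 1), MvPolynomial.X ⟨k, j⟩) -
    (∑ j : Fin (k : ℕ), MvPolynomial.X
      ⟨⟨(k : ℕ) - 1, by omega⟩, Fin.castLE (by simp only [mEta]; omega) j⟩) +
    MvPolynomial.C ((k : ℕ) : ℂ)

theorem neg_ePlus (k : ℕ) (hk : k + 1 < n) (i : Fin (k + 1)) :
    -ePlus n k hk i = algebraMap (PolN n) (KK n) (numPlus k hk i) /
      ∏ j ∈ Finset.univ.erase i, (XF n (mEta n) ⟨⟨k, Nat.lt_of_succ_lt hk⟩, i⟩ -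
        XF n (mEta n) ⟨⟨k, Nat.lt_of_succ_lt hk⟩, j⟩) := by
  rw [ePlus, numPlus, map_neg, map_prod]
  simp only [map_sub]
  exact (neg_div _ _).symm

theorem eMinus_eq (k : ℕ) (hk : k + 1 < n) (i : Fin (k + 1)) :
    eMinus n k hk i = algebraMap (PolN n) (KK n) (numMinus k hk i) /
      ∏ j ∈ Finset.univ.erase i, (XF n (mEta n) ⟨⟨k, Nat.lt_of_succ_lt hk⟩, i⟩ -
        XF n (mEta n) ⟨⟨k, Nat.lt_of_succ_lt hk⟩, j⟩) := by
  rw [eMinus, numMinus, map_prod]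
  simp only [map_sub]
  rfl

theorem actP_numPlus (σ : SgN n) (k : ℕ) (hk : k + 1 < n) (i : Fin (k + 1)) :
    actP n (mEta n) σ (numPlus k hk i) = numPlus k hk (σ ⟨k, Nat.lt_of_succ_lt hk⟩ i) := by
  rw [numPlus, numPlus, map_neg, map_prod]
  refine congrArg _ (Fintype.prod_equiv (σ ⟨k + 1, hk⟩) _ _ fun j => ?_)
  rw [map_sub, actP_X, actP_X]
  rfl

theorem actP_numMinus (σ : SgN n) (k : ℕ) (hk : k + 1 < n) (i : Fin (k + 1)) :
    actP n (mEta n) σ (numMinus k hk i) = numMinus k hk (σ ⟨k, Nat.lt_of_succ_lt hk⟩ i) := by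
  rw [numMinus, numMinus, map_prod]
  cases k with
  | zero => rfl
  | succ k =>
    refine Fintype.prod_equiv (σ ⟨k, by omega⟩) _ _ fun j => ?_
    rw [map_sub, actP_X, actP_X]
    rfl

theorem actP_weightP (σ : SgN n) (k : Fin n) :
    actP n (mEta n) σ (weightP k) = weightP k := by
  rw [weightP, map_add, map_sub, map_sum, map_sum, actP_C]
  refine congrArg₂ _ (congrArg₂ _ ?_ ?_) rfl
  · refine Fintype.sum_equiv (σ k) _ _ fun j => ?_
    rw [actP_X]
    rfl
  · obtain ⟨k, hk⟩ := k
    cases k with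
    | zero => rfl
    | succ k =>
      refine Fintype.sum_equiv (σ ⟨k, by omega⟩) _ _ fun j => ?_
      rw [actP_X]
      rfl

theorem actF_prod_erase (σ : SgN n) (k : Fin n) (i : Fin (mEta n k)) :
    actF n (mEta n) σ
        (∏ j ∈ Finset.univ.erase i, (XF n (mEta n) ⟨k, i⟩ - XF n (mEta n) ⟨k, j⟩)) =
      ∏ j ∈ Finset.univ.erase (σ k i),
        (XF n (mEta n) ⟨k, σ k i⟩ - XF n (mEta n) ⟨k, j⟩) := by
  rw [map_prod]
  refine Finset.prod_equiv (σ k) (fun j => by simp) fun j _ => ?_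
  rw [map_sub, actF_XF, actF_XF]
  rfl

theorem Hop_T (k : Fin n) (z : Z0 n) :
    Hop n k (T n z) =
      shiftK n (z : IdxN n → ℤ) (algebraMap (PolN n) (KK n) (weightP k)) • T n z := by
  refine ((Finsupp.lsum_single _ _ _ _).trans (one_smul _ _)).trans ?_
  refine congrArg (· • T n z) ?_
  rw [shiftK_algebraMap, weightP]
  simp only [map_add, map_sub, map_sum, shiftP_X, map_natCast, map_intCast]
  rfl

theorem map_mem_lattice_of_row
    (hmono : ∀ k : Fin n, Monotone fun i : Fin ((k : ℕ) + 1) => blk ⟨k, i⟩)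
    {PdV : SgN n → VK n → VK n}
    (hPdV : ∀ σ ∈ SgEta n blk, ∀ w : Word n (mEta n), IsRedB n blk σ w →
      ∀ x : VK n, PdV σ x = ddWordV n w x)
    (k : ℕ) (hk : k + 1 < n) (O : Module.End (KK n) (VK n))
    (f : Fin (k + 1) → PolN n) (d : Fin (k + 1) → Z0 n)
    (hO : ∀ z : Z0 n, O (T n z) = ∑ i, shiftK n (z : IdxN n → ℤ)
      (algebraMap (PolN n) (KK n) (f i) /
        ∏ j ∈ Finset.univ.erase i, (XF n (mEta n) ⟨⟨k, Nat.lt_of_succ_lt hk⟩, i⟩ -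
          XF n (mEta n) ⟨⟨k, Nat.lt_of_succ_lt hk⟩, j⟩)) • T n (z + d i))
    (hf : ∀ (σ : SgN n) i,
      actP n (mEta n) σ (f i) = f (σ ⟨k, Nat.lt_of_succ_lt hk⟩ i))
    (hd : ∀ (σ : SgN n) i, permZ0 n σ (d i) = d (σ ⟨k, Nat.lt_of_succ_lt hk⟩ i))
    {w : VK n} (hw : w ∈ lattice n blk PdV) : O w ∈ lattice n blk PdV := by
  refine map_mem_lattice hmono hPdV O
    (map_sact_of_shift O _ d (fun σ => σ ⟨k, Nat.lt_of_succ_lt hk⟩) hO (fun σ i => ?_) hd)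
    (fun z h hh => ?_) hw
  · rw [map_div₀, actF_algebraMap, hf]
    exact congrArg _ (actF_prod_erase σ ⟨k, Nat.lt_of_succ_lt hk⟩ i)
  · rw [hO]
    exact sum_smul_T_mem_span _ _ _ fun i =>
      mul_shiftK_div_mem_Balg (k := ⟨k, Nat.lt_of_succ_lt hk⟩) hh hk i _

theorem Eop_mem_lattice
    (hmono : ∀ k : Fin n, Monotone fun i : Fin ((k : ℕ) + 1) => blk ⟨k, i⟩)
    {PdV : SgN n → VK n → VK n}
    (hPdV : ∀ σ ∈ SgEta n blk, ∀ w : Word n (mEta n), IsRedB n blk σ w →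
      ∀ x : VK n, PdV σ x = ddWordV n w x)
    (k : ℕ) (hk : k + 1 < n) {w : VK n} (hw : w ∈ lattice n blk PdV) :
    Eop n k hk w ∈ lattice n blk PdV := by
  refine map_mem_lattice_of_row hmono hPdV k hk _ (numPlus k hk) (deltaZ n k hk)
    (fun z => ?_) (fun σ => actP_numPlus σ k hk) (fun σ => permZ0_deltaZ σ k hk) hw
  rw [Eop_T, ← Finset.sum_neg_distrib]
  refine Finset.sum_congr rfl fun i _ => ?_
  rw [← neg_ePlus, map_neg, neg_smul]

theorem Fop_mem_lattice
    (hmono : ∀ k : Fin n, Monotone fun i : Fin ((k : ℕ) + 1) => blk ⟨k, i⟩)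
    {PdV : SgN n → VK n → VK n}
    (hPdV : ∀ σ ∈ SgEta n blk, ∀ w : Word n (mEta n), IsRedB n blk σ w →
      ∀ x : VK n, PdV σ x = ddWordV n w x)
    (k : ℕ) (hk : k + 1 < n) {w : VK n} (hw : w ∈ lattice n blk PdV) :
    Fop n k hk w ∈ lattice n blk PdV := by
  refine map_mem_lattice_of_row hmono hPdV k hk _ (numMinus k hk) (fun i => -deltaZ n k hk i)
    (fun z => ?_) (fun σ => actP_numMinus σ k hk)
    (fun σ i => congrArg Neg.neg (permZ0_deltaZ σ k hk i)) hw
  rw [Fop_T]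
  refine Finset.sum_congr rfl fun i _ => ?_
  rw [← eMinus_eq, sub_eq_add_neg]

theorem Hop_mem_lattice
    (hmono : ∀ k : Fin n, Monotone fun i : Fin ((k : ℕ) + 1) => blk ⟨k, i⟩)
    {PdV : SgN n → VK n → VK n}
    (hPdV : ∀ σ ∈ SgEta n blk, ∀ w : Word n (mEta n), IsRedB n blk σ w →
      ∀ x : VK n, PdV σ x = ddWordV n w x)
    (k : Fin n) {w : VK n} (hw : w ∈ lattice n blk PdV) :
    Hop n k w ∈ lattice n blk PdV := by
  refine map_mem_lattice hmono hPdV _ (map_sact_of_shift (ι := Unit) _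
    (fun _ => algebraMap (PolN n) (KK n) (weightP k)) (fun _ => 0) (fun _ => 1) (fun z => ?_)
    (fun σ _ => ?_) fun σ _ => rfl) (fun z h _ => ?_) hw
  · rw [Hop_T, Fintype.sum_unique, add_zero]
  · rw [actF_algebraMap, actP_weightP]
  · rw [Hop_T, shiftK_algebraMap]
    exact smul_mem_of_mem_Balg (algebraMap_mem_Balg h)
      (smul_mem_of_mem_Balg (algebraMap_mem_Balg _) (Submodule.subset_span ⟨z, rfl⟩))

end Operators

/-- the lattice L_η is stable under all the Gelfand–Tsetlin operators
E_{k,k+1}, E_{k+1,k} (1 ≤ k ≤ n−1) and E_{k,k} (1 ≤ k ≤ n); that is, L_η is a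
U(gl(n,ℂ))-submodule of V_K.  Here `PdV` is the family of divided difference operators
∂_σ on V_K and L_η is the B_η-submodule of V_K generated by the D_σ^η T(z) = sym_η(∂_σ T(z))
with σ ∈ S_η and z ∈ ℤ^μ_0. -/
theorem statement16 (n : ℕ) (blk : IdxN n → ℕ)
    (hmono : ∀ k : Fin n, Monotone fun i : Fin ((k : ℕ) + 1) => blk ⟨k, i⟩)
    (htop : ∀ (k : Fin n) (i j : Fin ((k : ℕ) + 1)), (k : ℕ) + 1 = n →
      blk ⟨k, i⟩ = blk ⟨k, j⟩ → i = j)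
    (PdV : SgN n → VK n → VK n)
    (hPdV : ∀ σ ∈ SgEta n blk, ∀ w : Word n (mEta n), IsRedB n blk σ w →
      ∀ x : VK n, PdV σ x = ddWordV n w x) :
    ∀ w : VK n,
      w ∈ Submodule.span ↥(Balg n blk)
        {x : VK n | ∃ σ ∈ SgEta n blk, ∃ z : Z0 n, x = symV n blk (PdV σ (T n z))} →
      (∀ (k : ℕ) (hk : k + 1 < n),
        Eop n k hk w ∈ Submodule.span ↥(Balg n blk)
          {x : VK n | ∃ σ ∈ SgEta n blk, ∃ z : Z0 n, x = symV n blk (PdV σ (T n z))} ∧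
        Fop n k hk w ∈ Submodule.span ↥(Balg n blk)
          {x : VK n | ∃ σ ∈ SgEta n blk, ∃ z : Z0 n, x = symV n blk (PdV σ (T n z))}) ∧
      (∀ k : Fin n,
        Hop n k w ∈ Submodule.span ↥(Balg n blk)
          {x : VK n | ∃ σ ∈ SgEta n blk, ∃ z : Z0 n, x = symV n blk (PdV σ (T n z))}) := by
  intro w hw
  exact ⟨fun k hk => ⟨Eop_mem_lattice hmono hPdV k hk hw, Fop_mem_lattice hmono hPdV k hk hw⟩,
    fun k => Hop_mem_lattice hmono hPdV k hw⟩

end GTpaper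

end
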